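/- arXiv:1309.5250 — 2 statements merged into one kernel-verified Lean document; each statement's English description precedes it below -/
import Mathlib

section
/- Suppose MN > 0 and fix (P̲, f, c) ∈ R_{M,N}. There exists k ∈ ℤ_{>0} such that every weight μ of the universal Weyl module W(P̲, f, c) (i.e., every μ ∈ P_{M,N} with W(P̲, f, c)_μ ≠ 0) has the form λ_Λ − Σ_{i=1}^{M+N−1} u_i α_i with u_M − u_i > −k for all 1 ≤ i ≤ M+N−1. In particular, each of the operators X⁺_{i,0} and X⁻_{i,0} acts locally nilpotently on W(P̲, f, c), i.e., W(P̲, f, c) is integrable. -/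
noncomputable section

namespace QAS

open Polynomial
open scoped TensorProduct

/-! ### Basic combinatorial data -/

/-- `l_i = 1` for `i ≤ M`, `-1` otherwise. -/
def lof (M : ℕ) (i : ℕ) : ℤ := if i ≤ M then 1 else -1

/-- the bilinear form `(ε_i, ε_j) = l_i δ_{ij}`. -/
def innerE (M : ℕ) (i j : ℕ) : ℤ := if i = j then lof M i else 0

/-- `(ε_a − ε_b, ε_c − ε_d)`. -/
def form4 (M : ℕ) (a b c d : ℕ) : ℤ :=
  innerE M a c - innerE M a d - innerE M b c + innerE M b d

/-- the Cartan pairing `c_{ij} = (ε_i − ε_{i+1}, ε_j − ε_{j+1})`. -/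
def cc (M : ℕ) (i j : ℕ) : ℤ := form4 M i (i + 1) j (j + 1)

/-- `q_i = q^{l_i}`. -/
def qpar (q : ℂ) (M : ℕ) (i : ℕ) : ℂ := q ^ lof M i

/-- the quantum integer `[m]_v`. -/
def qint (v : ℂ) (m : ℤ) : ℂ := (v ^ m - v ^ (-m)) / (v - v⁻¹)

/-- the sign `(−1)^{|X_i||X_j|}` for the generators `X_i`, `X_j`. -/
def sgn (M : ℕ) (i j : ℕ) : ℂ := if i = M ∧ j = M then -1 else 1

/-- index set `1 ≤ i ≤ M+N−1`. -/
abbrev Idx (M N : ℕ) := {i : ℕ // 1 ≤ i ∧ i ≤ M + N - 1}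

/-! ### Generators and the free superalgebra -/

/-- Drinfel'd generators; when `ext = true` we also have `K₀^{±1}`. -/
inductive Gen (M N : ℕ) (ext : Bool) : Type
  | Xp : Idx M N → ℤ → Gen M N ext
  | Xm : Idx M N → ℤ → Gen M N ext
  | K : Idx M N → Gen M N ext
  | Ki : Idx M N → Gen M N ext
  | H : Idx M N → {s : ℤ // s ≠ 0} → Gen M N ext
  | K0 : ext = true → Gen M N ext
  | K0i : ext = true → Gen M N ext

abbrev FA (M N : ℕ) (ext : Bool) := FreeAlgebra ℂ (Gen M N ext)

def gi {M N : ℕ} {ext : Bool} (g : Gen M N ext) : FA M N ext := FreeAlgebra.ι ℂ g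

def XpF (M N : ℕ) (ext : Bool) (i : ℕ) (n : ℤ) : FA M N ext :=
  if h : 1 ≤ i ∧ i ≤ M + N - 1 then gi (Gen.Xp ⟨i, h⟩ n) else 0

def XmF (M N : ℕ) (ext : Bool) (i : ℕ) (n : ℤ) : FA M N ext :=
  if h : 1 ≤ i ∧ i ≤ M + N - 1 then gi (Gen.Xm ⟨i, h⟩ n) else 0

def KF (M N : ℕ) (ext : Bool) (i : ℕ) : FA M N ext :=
  if h : 1 ≤ i ∧ i ≤ M + N - 1 then gi (Gen.K ⟨i, h⟩) else 0

def KiF (M N : ℕ) (ext : Bool) (i : ℕ) : FA M N ext :=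
  if h : 1 ≤ i ∧ i ≤ M + N - 1 then gi (Gen.Ki ⟨i, h⟩) else 0

def HF (M N : ℕ) (ext : Bool) (i : ℕ) (s : ℤ) : FA M N ext :=
  if h : (1 ≤ i ∧ i ≤ M + N - 1) ∧ s ≠ 0 then gi (Gen.H ⟨i, h.1⟩ ⟨s, h.2⟩) else 0

def K0F (M N : ℕ) (ext : Bool) : FA M N ext :=
  if h : ext = true then gi (Gen.K0 h) else 0

def K0iF (M N : ℕ) (ext : Bool) : FA M N ext :=
  if h : ext = true then gi (Gen.K0i h) else 0

/-- coefficients of `exp (t · Σ_{s ≥ 1} a_s z^s)`. -/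
def expC {A : Type} [Ring A] [Algebra ℂ A] (t : ℂ) (a : ℕ → A) : ℕ → A
  | 0 => 1
  | n + 1 =>
      ((n : ℂ) + 1)⁻¹ •
        (t • ∑ s ∈ Finset.range (n + 1), ((s : ℂ) + 1) • (a (s + 1) * expC t a (n - s)))
termination_by n => n
decreasing_by omega

/-- `φ⁺_{i,n}`, the coefficient of `z^n` in
`K_i exp((q_i − q_i⁻¹) Σ_{s>0} h_{i,s} z^s)`. -/
def phiPF (q : ℂ) (M N : ℕ) (ext : Bool) (i : ℕ) (n : ℤ) : FA M N ext :=
  if 0 ≤ n then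
    KF M N ext i *
      expC (qpar q M i - (qpar q M i)⁻¹) (fun s => HF M N ext i (s : ℤ)) n.toNat
  else 0

/-- `φ⁻_{i,n}`, the coefficient of `z^n` (`n ≤ 0`) in
`K_i⁻¹ exp(−(q_i − q_i⁻¹) Σ_{s>0} h_{i,−s} z^{−s})`. -/
def phiMF (q : ℂ) (M N : ℕ) (ext : Bool) (i : ℕ) (n : ℤ) : FA M N ext :=
  if n ≤ 0 then
    KiF M N ext i *
      expC (-(qpar q M i - (qpar q M i)⁻¹)) (fun s => HF M N ext i (-(s : ℤ))) (-n).toNat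
  else 0

/-- the `u`-bracket `[x,y]_u = xy − u·yx` (for `x` or `y` of even parity). -/
def brF {A : Type} [Ring A] [Module ℂ A] (u : ℂ) (x y : A) : A := x * y - u • (y * x)

/-- the quartic oscillation expression
`[[[X_{M−1,m}, X_{M,n}]_{q⁻¹}, X_{M+1,k}]_q, X_{M,u}]` (a graded anticommutator in the
outermost bracket, both entries being odd). -/
def oscOf {A : Type} [Ring A] [Module ℂ A] (q : ℂ) (M : ℕ) (X : ℕ → ℤ → A) (m n k u : ℤ) : A :=
  brF q (brF q⁻¹ (X (M - 1) m) (X M n)) (X (M + 1) k) * X M u +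
    X M u * brF q (brF q⁻¹ (X (M - 1) m) (X M n)) (X (M + 1) k)

/-! ### The defining relations.
`lvl = 1`: only (R1)–(R3);  `lvl = 2`: (R1)–(R5);  `lvl = 3`: all of (R1)–(R7).
`ext = true` adds `K₀^{±1}` together with its relations. -/

inductive rel (q : ℂ) (M N : ℕ) (ext : Bool) (lvl : ℕ) : FA M N ext → FA M N ext → Prop
  | KKi (i : Idx M N) : rel q M N ext lvl (gi (Gen.K i) * gi (Gen.Ki i)) 1
  | KiK (i : Idx M N) : rel q M N ext lvl (gi (Gen.Ki i) * gi (Gen.K i)) 1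
  | KK (i j : Idx M N) :
      rel q M N ext lvl (gi (Gen.K i) * gi (Gen.K j)) (gi (Gen.K j) * gi (Gen.K i))
  | KKi2 (i j : Idx M N) :
      rel q M N ext lvl (gi (Gen.K i) * gi (Gen.Ki j)) (gi (Gen.Ki j) * gi (Gen.K i))
  | KiKi (i j : Idx M N) :
      rel q M N ext lvl (gi (Gen.Ki i) * gi (Gen.Ki j)) (gi (Gen.Ki j) * gi (Gen.Ki i))
  | KH (i j : Idx M N) (s : {s : ℤ // s ≠ 0}) :
      rel q M N ext lvl (gi (Gen.K i) * gi (Gen.H j s)) (gi (Gen.H j s) * gi (Gen.K i))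
  | KiH (i j : Idx M N) (s : {s : ℤ // s ≠ 0}) :
      rel q M N ext lvl (gi (Gen.Ki i) * gi (Gen.H j s)) (gi (Gen.H j s) * gi (Gen.Ki i))
  | HH (i j : Idx M N) (s t : {s : ℤ // s ≠ 0}) :
      rel q M N ext lvl (gi (Gen.H i s) * gi (Gen.H j t)) (gi (Gen.H j t) * gi (Gen.H i s))
  | KXp (i j : Idx M N) (n : ℤ) :
      rel q M N ext lvl (gi (Gen.K i) * gi (Gen.Xp j n))
        ((q ^ cc M i.1 j.1) • (gi (Gen.Xp j n) * gi (Gen.K i)))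
  | KXm (i j : Idx M N) (n : ℤ) :
      rel q M N ext lvl (gi (Gen.K i) * gi (Gen.Xm j n))
        ((q ^ (-cc M i.1 j.1)) • (gi (Gen.Xm j n) * gi (Gen.K i)))
  | HXp (i j : Idx M N) (s : {s : ℤ // s ≠ 0}) (n : ℤ) :
      rel q M N ext lvl
        (gi (Gen.H i s) * gi (Gen.Xp j n) - gi (Gen.Xp j n) * gi (Gen.H i s))
        ((qint (qpar q M i.1) (s.1 * lof M i.1 * cc M i.1 j.1) / (s.1 : ℂ)) •
          gi (Gen.Xp j (n + s.1)))
  | HXm (i j : Idx M N) (s : {s : ℤ // s ≠ 0}) (n : ℤ) :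
      rel q M N ext lvl
        (gi (Gen.H i s) * gi (Gen.Xm j n) - gi (Gen.Xm j n) * gi (Gen.H i s))
        (-((qint (qpar q M i.1) (s.1 * lof M i.1 * cc M i.1 j.1) / (s.1 : ℂ)) •
          gi (Gen.Xm j (n + s.1))))
  | XpXm (i j : Idx M N) (m n : ℤ) :
      rel q M N ext lvl
        (gi (Gen.Xp i m) * gi (Gen.Xm j n) -
          sgn M i.1 j.1 • (gi (Gen.Xm j n) * gi (Gen.Xp i m)))
        (if i = j then
            (qpar q M i.1 - (qpar q M i.1)⁻¹)⁻¹ •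
              (phiPF q M N ext i.1 (m + n) - phiMF q M N ext i.1 (m + n))
          else 0)
  | XX0p (i j : Idx M N) (m n : ℤ) (h2 : 2 ≤ lvl) (h : cc M i.1 j.1 = 0) :
      rel q M N ext lvl
        (gi (Gen.Xp i m) * gi (Gen.Xp j n) -
          sgn M i.1 j.1 • (gi (Gen.Xp j n) * gi (Gen.Xp i m))) 0
  | XX0m (i j : Idx M N) (m n : ℤ) (h2 : 2 ≤ lvl) (h : cc M i.1 j.1 = 0) :
      rel q M N ext lvl
        (gi (Gen.Xm i m) * gi (Gen.Xm j n) -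
          sgn M i.1 j.1 • (gi (Gen.Xm j n) * gi (Gen.Xm i m))) 0
  | XXp (i j : Idx M N) (m n : ℤ) (h2 : 2 ≤ lvl) (h : cc M i.1 j.1 ≠ 0) :
      rel q M N ext lvl
        (gi (Gen.Xp i (m + 1)) * gi (Gen.Xp j n) -
          (q ^ cc M i.1 j.1) • (gi (Gen.Xp j n) * gi (Gen.Xp i (m + 1))))
        ((q ^ cc M i.1 j.1) • (gi (Gen.Xp i m) * gi (Gen.Xp j (n + 1))) -
          gi (Gen.Xp j (n + 1)) * gi (Gen.Xp i m))
  | XXm (i j : Idx M N) (m n : ℤ) (h2 : 2 ≤ lvl) (h : cc M i.1 j.1 ≠ 0) :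
      rel q M N ext lvl
        (gi (Gen.Xm i (m + 1)) * gi (Gen.Xm j n) -
          (q ^ (-cc M i.1 j.1)) • (gi (Gen.Xm j n) * gi (Gen.Xm i (m + 1))))
        ((q ^ (-cc M i.1 j.1)) • (gi (Gen.Xm i m) * gi (Gen.Xm j (n + 1))) -
          gi (Gen.Xm j (n + 1)) * gi (Gen.Xm i m))
  | serreP (i j : Idx M N) (m n k : ℤ) (h3 : 3 ≤ lvl)
      (h : cc M i.1 j.1 = 1 ∨ cc M i.1 j.1 = -1) (hi : i.1 ≠ M) :
      rel q M N ext lvl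
        (brF q (gi (Gen.Xp i m)) (brF q⁻¹ (gi (Gen.Xp i n)) (gi (Gen.Xp j k))) +
          brF q (gi (Gen.Xp i n)) (brF q⁻¹ (gi (Gen.Xp i m)) (gi (Gen.Xp j k)))) 0
  | serreM (i j : Idx M N) (m n k : ℤ) (h3 : 3 ≤ lvl)
      (h : cc M i.1 j.1 = 1 ∨ cc M i.1 j.1 = -1) (hi : i.1 ≠ M) :
      rel q M N ext lvl
        (brF q (gi (Gen.Xm i m)) (brF q⁻¹ (gi (Gen.Xm i n)) (gi (Gen.Xm j k))) +
          brF q (gi (Gen.Xm i n)) (brF q⁻¹ (gi (Gen.Xm i m)) (gi (Gen.Xm j k)))) 0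
  | oscP (m n k u : ℤ) (h3 : 3 ≤ lvl) (hM : 1 < M) (hN : 1 < N) :
      rel q M N ext lvl
        (oscOf q M (XpF M N ext) m n k u + oscOf q M (XpF M N ext) m u k n) 0
  | oscM (m n k u : ℤ) (h3 : 3 ≤ lvl) (hM : 1 < M) (hN : 1 < N) :
      rel q M N ext lvl
        (oscOf q M (XmF M N ext) m n k u + oscOf q M (XmF M N ext) m u k n) 0
  | K0K0i (he : ext = true) : rel q M N ext lvl (gi (Gen.K0 he) * gi (Gen.K0i he)) 1
  | K0iK0 (he : ext = true) : rel q M N ext lvl (gi (Gen.K0i he) * gi (Gen.K0 he)) 1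
  | K0K (he : ext = true) (i : Idx M N) :
      rel q M N ext lvl (gi (Gen.K0 he) * gi (Gen.K i)) (gi (Gen.K i) * gi (Gen.K0 he))
  | K0Ki (he : ext = true) (i : Idx M N) :
      rel q M N ext lvl (gi (Gen.K0 he) * gi (Gen.Ki i)) (gi (Gen.Ki i) * gi (Gen.K0 he))
  | K0H (he : ext = true) (i : Idx M N) (s : {s : ℤ // s ≠ 0}) :
      rel q M N ext lvl (gi (Gen.K0 he) * gi (Gen.H i s)) (gi (Gen.H i s) * gi (Gen.K0 he))
  | K0Xp (he : ext = true) (i : Idx M N) (n : ℤ) :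
      rel q M N ext lvl (gi (Gen.K0 he) * gi (Gen.Xp i n))
        ((q ^ (if i.1 = 1 then (1 : ℤ) else 0)) • (gi (Gen.Xp i n) * gi (Gen.K0 he)))
  | K0Xm (he : ext = true) (i : Idx M N) (n : ℤ) :
      rel q M N ext lvl (gi (Gen.K0 he) * gi (Gen.Xm i n))
        ((q ^ (if i.1 = 1 then (-1 : ℤ) else 0)) • (gi (Gen.Xm i n) * gi (Gen.K0 he)))

/-! ### The quantum affine superalgebras -/

abbrev ALG (q : ℂ) (M N : ℕ) (ext : Bool) (lvl : ℕ) := RingQuot (rel q M N ext lvl)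

def mkA (q : ℂ) (M N : ℕ) (ext : Bool) (lvl : ℕ) : FA M N ext →ₐ[ℂ] ALG q M N ext lvl :=
  RingQuot.mkAlgHom ℂ (rel q M N ext lvl)

def XpA (q : ℂ) (M N : ℕ) (ext : Bool) (lvl : ℕ) (i : ℕ) (n : ℤ) : ALG q M N ext lvl :=
  mkA q M N ext lvl (XpF M N ext i n)

def XmA (q : ℂ) (M N : ℕ) (ext : Bool) (lvl : ℕ) (i : ℕ) (n : ℤ) : ALG q M N ext lvl :=
  mkA q M N ext lvl (XmF M N ext i n)

def KA (q : ℂ) (M N : ℕ) (ext : Bool) (lvl : ℕ) (i : ℕ) : ALG q M N ext lvl :=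
  mkA q M N ext lvl (KF M N ext i)

def KiA (q : ℂ) (M N : ℕ) (ext : Bool) (lvl : ℕ) (i : ℕ) : ALG q M N ext lvl :=
  mkA q M N ext lvl (KiF M N ext i)

def HA (q : ℂ) (M N : ℕ) (ext : Bool) (lvl : ℕ) (i : ℕ) (s : ℤ) : ALG q M N ext lvl :=
  mkA q M N ext lvl (HF M N ext i s)

def K0A (q : ℂ) (M N : ℕ) (ext : Bool) (lvl : ℕ) : ALG q M N ext lvl :=
  mkA q M N ext lvl (K0F M N ext)

def K0iA (q : ℂ) (M N : ℕ) (ext : Bool) (lvl : ℕ) : ALG q M N ext lvl :=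
  mkA q M N ext lvl (K0iF M N ext)

def phiPA (q : ℂ) (M N : ℕ) (ext : Bool) (lvl : ℕ) (i : ℕ) (n : ℤ) : ALG q M N ext lvl :=
  mkA q M N ext lvl (phiPF q M N ext i n)

def phiMA (q : ℂ) (M N : ℕ) (ext : Bool) (lvl : ℕ) (i : ℕ) (n : ℤ) : ALG q M N ext lvl :=
  mkA q M N ext lvl (phiMF q M N ext i n)

/-- `U⁺`: the subalgebra generated by the `X⁺_{i,n}`. -/
def Aplus (q : ℂ) (M N : ℕ) (ext : Bool) (lvl : ℕ) : Subalgebra ℂ (ALG q M N ext lvl) :=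
  Algebra.adjoin ℂ {x | ∃ i : ℕ, ∃ n : ℤ, x = XpA q M N ext lvl i n}

/-- `U⁻`: the subalgebra generated by the `X⁻_{i,n}`. -/
def Aminus (q : ℂ) (M N : ℕ) (ext : Bool) (lvl : ℕ) : Subalgebra ℂ (ALG q M N ext lvl) :=
  Algebra.adjoin ℂ {x | ∃ i : ℕ, ∃ n : ℤ, x = XmA q M N ext lvl i n}

/-- `U⁰`: the subalgebra generated by the `K_i^{±1}` and `h_{i,s}`. -/
def Azero (q : ℂ) (M N : ℕ) (ext : Bool) (lvl : ℕ) : Subalgebra ℂ (ALG q M N ext lvl) :=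
  Algebra.adjoin ℂ {x | (∃ i : ℕ, x = KA q M N ext lvl i) ∨ (∃ i : ℕ, x = KiA q M N ext lvl i) ∨
    ∃ i : ℕ, ∃ s : ℤ, x = HA q M N ext lvl i s}

/-- `U'⁰`: the subalgebra generated by `U⁰` and `K₀^{±1}`. -/
def AzeroE (q : ℂ) (M N : ℕ) (ext : Bool) (lvl : ℕ) : Subalgebra ℂ (ALG q M N ext lvl) :=
  Algebra.adjoin ℂ {x | (∃ i : ℕ, x = KA q M N ext lvl i) ∨ (∃ i : ℕ, x = KiA q M N ext lvl i) ∨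
    (∃ i : ℕ, ∃ s : ℤ, x = HA q M N ext lvl i s) ∨ x = K0A q M N ext lvl ∨
      x = K0iA q M N ext lvl}

/-! ### The multiplication map on the triple tensor product -/

def triMul (q : ℂ) (M N : ℕ) (ext : Bool) (lvl : ℕ)
    (S T R : Subalgebra ℂ (ALG q M N ext lvl)) :
    (↥S ⊗[ℂ] (↥T ⊗[ℂ] ↥R)) →ₗ[ℂ] ALG q M N ext lvl :=
  TensorProduct.lift
    (((LinearMap.mul ℂ (ALG q M N ext lvl)).comp S.val.toLinearMap).compl₂
      (TensorProduct.lift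
        (((LinearMap.mul ℂ (ALG q M N ext lvl)).comp T.val.toLinearMap).compl₂
          R.val.toLinearMap)))

/-! ### Root vectors and PBW monomials -/

def Xroot (q : ℂ) (M N : ℕ) (ext : Bool) (lvl : ℕ) (i : ℕ) : ℕ → ℤ → ALG q M N ext lvl
  | 0, n => XpA q M N ext lvl i n
  | k + 1, n =>
      brF (qpar q M (i + k + 1)) (Xroot q M N ext lvl i k n) (XpA q M N ext lvl (i + k + 1) 0)

/-- the root vector `X_{α_i + ⋯ + α_j}(n)`. -/
def XrootIJ (q : ℂ) (M N : ℕ) (ext : Bool) (lvl : ℕ) (i j : ℕ) (n : ℤ) : ALG q M N ext lvl :=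
  Xroot q M N ext lvl i (j - i) n

def rootLE (a b : ℕ × ℕ) : Prop := a.1 < b.1 ∨ (a.1 = b.1 ∧ a.2 ≤ b.2)

/-- the set of PBW ordered monomials in the root vectors. -/
def pbwSet (q : ℂ) (M N : ℕ) (ext : Bool) (lvl : ℕ) : Set (ALG q M N ext lvl) :=
  {x | ∃ L : List ((ℕ × ℕ) × ℤ),
      (∀ p ∈ L, 1 ≤ p.1.1 ∧ p.1.1 ≤ p.1.2 ∧ p.1.2 ≤ M + N - 1) ∧
      L.Chain' (fun a b => rootLE a.1 b.1) ∧
      x = (L.map fun p => XrootIJ q M N ext lvl p.1.1 p.1.2 p.2).prod}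

/-- PBW ordered monomials of total degree `d` (`d i` counts the multiplicity of `α_i`). -/
def pbwDegSet (q : ℂ) (M N : ℕ) (ext : Bool) (lvl : ℕ) (d : ℕ → ℕ) : Set (ALG q M N ext lvl) :=
  {x | ∃ L : List ((ℕ × ℕ) × ℤ),
      (∀ p ∈ L, 1 ≤ p.1.1 ∧ p.1.1 ≤ p.1.2 ∧ p.1.2 ≤ M + N - 1) ∧
      L.Chain' (fun a b => rootLE a.1 b.1) ∧
      (∀ i : ℕ, ((L.map fun p => if p.1.1 ≤ i ∧ i ≤ p.1.2 then 1 else 0).sum) = d i) ∧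
      x = (L.map fun p => XrootIJ q M N ext lvl p.1.1 p.1.2 p.2).prod}

/-- words in the generators `X⁺_{i,n}` of degree `d`. -/
def wordDegSet (q : ℂ) (M N : ℕ) (ext : Bool) (lvl : ℕ) (d : ℕ → ℕ) :
    Set (ALG q M N ext lvl) :=
  {x | ∃ w : List (ℕ × ℤ), (∀ p ∈ w, 1 ≤ p.1 ∧ p.1 ≤ M + N - 1) ∧
      (∀ i : ℕ, (w.map Prod.fst).count i = d i) ∧
      x = (w.map fun p => XpA q M N ext lvl p.1 p.2).prod}

/-! ### The subspaces `I^±_{i,j}` and `O^±` -/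

def IElt (q : ℂ) (M N : ℕ) (ext : Bool) (lvl : ℕ) (pl : Bool) (i j : ℕ) (m n : ℤ) :
    ALG q M N ext lvl :=
  let X : ℕ → ℤ → ALG q M N ext lvl := if pl then XpA q M N ext lvl else XmA q M N ext lvl
  let e : ℤ := if pl then cc M i j else -cc M i j
  if cc M i j = 0 then X i m * X j n - sgn M i j • (X j n * X i m)
  else
    X i (m + 1) * X j n - (q ^ e) • (X j n * X i (m + 1)) -
      (q ^ e) • (X i m * X j (n + 1)) + X j (n + 1) * X i m

def Isub (q : ℂ) (M N : ℕ) (ext : Bool) (lvl : ℕ) (pl : Bool) (i j : ℕ) :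
    Submodule ℂ (ALG q M N ext lvl) :=
  Submodule.span ℂ (Set.range fun p : ℤ × ℤ => IElt q M N ext lvl pl i j p.1 p.2)

def IsubAll (q : ℂ) (M N : ℕ) (ext : Bool) (lvl : ℕ) (pl : Bool) :
    Submodule ℂ (ALG q M N ext lvl) :=
  ⨆ p : ℕ × ℕ, ⨆ _ : 1 ≤ p.1 ∧ p.1 ≤ p.2 ∧ p.2 ≤ M + N - 1,
    Isub q M N ext lvl pl p.1 p.2

def OscElt (q : ℂ) (M N : ℕ) (ext : Bool) (lvl : ℕ) (pl : Bool) (m n k u : ℤ) :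
    ALG q M N ext lvl :=
  let X : ℕ → ℤ → ALG q M N ext lvl := if pl then XpA q M N ext lvl else XmA q M N ext lvl
  oscOf q M X m n k u + oscOf q M X m u k n

def Osub (q : ℂ) (M N : ℕ) (ext : Bool) (lvl : ℕ) (pl : Bool) :
    Submodule ℂ (ALG q M N ext lvl) :=
  Submodule.span ℂ
    (Set.range fun p : ℤ × ℤ × ℤ × ℤ => OscElt q M N ext lvl pl p.1 p.2.1 p.2.2.1 p.2.2.2)

/-- the sign `(−1)^{(p(α_k)+p(α_u))·p(α_i)}`. -/
def gsgn (M : ℕ) (k u i : ℕ) : ℂ :=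
  if ((k = M ∧ ¬u = M) ∨ (¬k = M ∧ u = M)) ∧ i = M then -1 else 1

/-! ### Highest weights and the associated eigenvalue sequences -/

/-- `Q·f = 0` for a bilateral formal series `f`. -/
def annih (Q : Polynomial ℂ) (f : ℤ → ℂ) : Prop :=
  ∀ n : ℤ, ∑ s ∈ Finset.range (Q.natDegree + 1), Q.coeff s * f (n - s) = 0

/-- an element of `R_{M,N}`: a highest weight `(P̲, f, c)`. -/
structure HW (q : ℂ) (M N : ℕ) : Type where
  P : ℕ → Polynomial ℂ
  f : ℤ → ℂ
  c : ℂ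
  P_const : ∀ i, (P i).coeff 0 = 1
  c_ne : c ≠ 0
  torsion : ∃ Q : Polynomial ℂ, Q ≠ 0 ∧ annih Q f
  f_zero : f 0 = (c - c⁻¹) / (q - q⁻¹)

def toPS (p : Polynomial ℂ) : PowerSeries ℂ := PowerSeries.mk fun n => p.coeff n

/-- `P(z·u)`. -/
def pscale (u : ℂ) (P : Polynomial ℂ) : Polynomial ℂ := P.comp (Polynomial.C u * Polynomial.X)

/-- the coefficient of `z^n` (`n ≥ 0`) in `q_i^{deg P} P(z q_i⁻¹)/P(z q_i)`,
expanded at `z = 0`. -/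
def gammaP (q : ℂ) (M : ℕ) (i : ℕ) (P : Polynomial ℂ) (n : ℤ) : ℂ :=
  if 0 ≤ n then
    qpar q M i ^ P.natDegree *
      PowerSeries.coeff n.toNat
        (toPS (pscale (qpar q M i)⁻¹ P) * (toPS (pscale (qpar q M i) P))⁻¹)
  else 0

/-- the coefficient of `z^n` (`n ≤ 0`) in `q_i^{deg P} P(z q_i⁻¹)/P(z q_i)`,
expanded at `z = ∞`. -/
def gammaM (q : ℂ) (M : ℕ) (i : ℕ) (P : Polynomial ℂ) (n : ℤ) : ℂ :=
  if n ≤ 0 then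
    qpar q M i ^ P.natDegree *
      PowerSeries.coeff (-n).toNat
        (toPS ((pscale (qpar q M i)⁻¹ P).reflect P.natDegree) *
          (toPS ((pscale (qpar q M i) P).reflect P.natDegree))⁻¹)
  else 0

/-! ### Verma, Weyl and simple modules -/

def vermaRels (q : ℂ) (M N : ℕ) (ext : Bool) (Λ : HW q M N) : Set (ALG q M N ext 3) :=
  {x | ∃ i : ℕ, ∃ n : ℤ, x = XpA q M N ext 3 i n} ∪
  {x | ∃ i : ℕ, ∃ n : ℤ, 1 ≤ i ∧ i ≤ M + N - 1 ∧ i ≠ M ∧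
      (x = phiPA q M N ext 3 i n - algebraMap ℂ _ (gammaP q M i (Λ.P i) n) ∨
       x = phiMA q M N ext 3 i n - algebraMap ℂ _ (gammaM q M i (Λ.P i) n))} ∪
  {x | x = KA q M N ext 3 M - algebraMap ℂ _ Λ.c} ∪
  {x | ∃ n : ℤ, x = phiPA q M N ext 3 M n - phiMA q M N ext 3 M n -
      algebraMap ℂ _ ((q - q⁻¹) * Λ.f n)} ∪
  {x | ext = true ∧ x = K0A q M N ext 3 - 1}

def evenRels (q : ℂ) (M N : ℕ) (ext : Bool) (Λ : HW q M N) : Set (ALG q M N ext 3) :=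
  {x | ∃ i : ℕ, 1 ≤ i ∧ i ≤ M + N - 1 ∧ i ≠ M ∧
      x = XmA q M N ext 3 i 0 ^ (1 + (Λ.P i).natDegree)}

def oddElt (q : ℂ) (M N : ℕ) (ext : Bool) (Q : Polynomial ℂ) (n : ℤ) : ALG q M N ext 3 :=
  ∑ s ∈ Finset.range (Q.natDegree + 1),
    Q.coeff (Q.natDegree - s) • XmA q M N ext 3 M ((s : ℤ) + n)

def oddRels (q : ℂ) (M N : ℕ) (ext : Bool) (Q : Polynomial ℂ) : Set (ALG q M N ext 3) :=
  if M = 1 ∧ N = 1 then {x | ∃ n : ℤ, x = oddElt q M N ext Q n}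
  else {oddElt q M N ext Q 0}

def vermaIdeal (q : ℂ) (M N : ℕ) (ext : Bool) (Λ : HW q M N) : Ideal (ALG q M N ext 3) :=
  Ideal.span (vermaRels q M N ext Λ)

def weylIdeal (q : ℂ) (M N : ℕ) (ext : Bool) (Λ : HW q M N) (Q : Polynomial ℂ) :
    Ideal (ALG q M N ext 3) :=
  Ideal.span (vermaRels q M N ext Λ ∪ evenRels q M N ext Λ ∪ oddRels q M N ext Q)

def uweylIdeal (q : ℂ) (M N : ℕ) (ext : Bool) (Λ : HW q M N) : Ideal (ALG q M N ext 3) :=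
  Ideal.span (vermaRels q M N ext Λ ∪ evenRels q M N ext Λ)

/-- the Verma module `M(Λ)`. -/
def VermaMod (q : ℂ) (M N : ℕ) (ext : Bool) (Λ : HW q M N) : Type :=
  ALG q M N ext 3 ⧸ vermaIdeal q M N ext Λ

/-- the Weyl module `W(Λ; Q)`. -/
def WeylMod (q : ℂ) (M N : ℕ) (ext : Bool) (Λ : HW q M N) (Q : Polynomial ℂ) : Type :=
  ALG q M N ext 3 ⧸ weylIdeal q M N ext Λ Q

/-- the universal Weyl module `W(Λ)`. -/
def UWeylMod (q : ℂ) (M N : ℕ) (ext : Bool) (Λ : HW q M N) : Type :=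
  ALG q M N ext 3 ⧸ uweylIdeal q M N ext Λ

instance (q : ℂ) (M N : ℕ) (ext : Bool) (Λ : HW q M N) : AddCommGroup (VermaMod q M N ext Λ) :=
  inferInstanceAs (AddCommGroup (ALG q M N ext 3 ⧸ vermaIdeal q M N ext Λ))
instance (q : ℂ) (M N : ℕ) (ext : Bool) (Λ : HW q M N) :
    Module (ALG q M N ext 3) (VermaMod q M N ext Λ) :=
  inferInstanceAs (Module (ALG q M N ext 3) (ALG q M N ext 3 ⧸ vermaIdeal q M N ext Λ))
instance (q : ℂ) (M N : ℕ) (ext : Bool) (Λ : HW q M N) : Module ℂ (VermaMod q M N ext Λ) :=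
  inferInstanceAs (Module ℂ (ALG q M N ext 3 ⧸ vermaIdeal q M N ext Λ))
instance (q : ℂ) (M N : ℕ) (ext : Bool) (Λ : HW q M N) :
    IsScalarTower ℂ (ALG q M N ext 3) (VermaMod q M N ext Λ) :=
  inferInstanceAs (IsScalarTower ℂ (ALG q M N ext 3) (ALG q M N ext 3 ⧸ vermaIdeal q M N ext Λ))

instance (q : ℂ) (M N : ℕ) (ext : Bool) (Λ : HW q M N) (Q : Polynomial ℂ) :
    AddCommGroup (WeylMod q M N ext Λ Q) :=
  inferInstanceAs (AddCommGroup (ALG q M N ext 3 ⧸ weylIdeal q M N ext Λ Q))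
instance (q : ℂ) (M N : ℕ) (ext : Bool) (Λ : HW q M N) (Q : Polynomial ℂ) :
    Module (ALG q M N ext 3) (WeylMod q M N ext Λ Q) :=
  inferInstanceAs (Module (ALG q M N ext 3) (ALG q M N ext 3 ⧸ weylIdeal q M N ext Λ Q))
instance (q : ℂ) (M N : ℕ) (ext : Bool) (Λ : HW q M N) (Q : Polynomial ℂ) :
    Module ℂ (WeylMod q M N ext Λ Q) :=
  inferInstanceAs (Module ℂ (ALG q M N ext 3 ⧸ weylIdeal q M N ext Λ Q))
instance (q : ℂ) (M N : ℕ) (ext : Bool) (Λ : HW q M N) (Q : Polynomial ℂ) :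
    IsScalarTower ℂ (ALG q M N ext 3) (WeylMod q M N ext Λ Q) :=
  inferInstanceAs
    (IsScalarTower ℂ (ALG q M N ext 3) (ALG q M N ext 3 ⧸ weylIdeal q M N ext Λ Q))

instance (q : ℂ) (M N : ℕ) (ext : Bool) (Λ : HW q M N) : AddCommGroup (UWeylMod q M N ext Λ) :=
  inferInstanceAs (AddCommGroup (ALG q M N ext 3 ⧸ uweylIdeal q M N ext Λ))
instance (q : ℂ) (M N : ℕ) (ext : Bool) (Λ : HW q M N) :
    Module (ALG q M N ext 3) (UWeylMod q M N ext Λ) :=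
  inferInstanceAs (Module (ALG q M N ext 3) (ALG q M N ext 3 ⧸ uweylIdeal q M N ext Λ))
instance (q : ℂ) (M N : ℕ) (ext : Bool) (Λ : HW q M N) : Module ℂ (UWeylMod q M N ext Λ) :=
  inferInstanceAs (Module ℂ (ALG q M N ext 3 ⧸ uweylIdeal q M N ext Λ))
instance (q : ℂ) (M N : ℕ) (ext : Bool) (Λ : HW q M N) :
    IsScalarTower ℂ (ALG q M N ext 3) (UWeylMod q M N ext Λ) :=
  inferInstanceAs (IsScalarTower ℂ (ALG q M N ext 3) (ALG q M N ext 3 ⧸ uweylIdeal q M N ext Λ))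

/-- the highest weight vector (image of `1`). -/
def vgen (q : ℂ) (M N : ℕ) (Λ : HW q M N) : VermaMod q M N true Λ :=
  Submodule.Quotient.mk 1

/-- the sum of all submodules not containing the highest weight vector (the unique
maximal submodule of the Verma module). -/
def radV (q : ℂ) (M N : ℕ) (Λ : HW q M N) :
    Submodule (ALG q M N true 3) (VermaMod q M N true Λ) :=
  sSup {p | vgen q M N Λ ∉ p}

/-- the simple quotient `S'(Λ)`. -/
def SimpMod (q : ℂ) (M N : ℕ) (Λ : HW q M N) : Type :=
  VermaMod q M N true Λ ⧸ radV q M N Λ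

instance (q : ℂ) (M N : ℕ) (Λ : HW q M N) : AddCommGroup (SimpMod q M N Λ) :=
  inferInstanceAs (AddCommGroup (VermaMod q M N true Λ ⧸ radV q M N Λ))
instance (q : ℂ) (M N : ℕ) (Λ : HW q M N) :
    Module (ALG q M N true 3) (SimpMod q M N Λ) :=
  inferInstanceAs (Module (ALG q M N true 3) (VermaMod q M N true Λ ⧸ radV q M N Λ))
instance (q : ℂ) (M N : ℕ) (Λ : HW q M N) : Module ℂ (SimpMod q M N Λ) :=
  inferInstanceAs (Module ℂ (VermaMod q M N true Λ ⧸ radV q M N Λ))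
instance (q : ℂ) (M N : ℕ) (Λ : HW q M N) :
    IsScalarTower ℂ (ALG q M N true 3) (SimpMod q M N Λ) :=
  inferInstanceAs (IsScalarTower ℂ (ALG q M N true 3) (VermaMod q M N true Λ ⧸ radV q M N Λ))

/-! ### Weight spaces -/

/-- `K_i` for `0 ≤ i`, with `K₀` at `i = 0`. -/
def Kgen (q : ℂ) (M N : ℕ) (ext : Bool) (lvl : ℕ) (i : ℕ) : ALG q M N ext lvl :=
  if i = 0 then K0A q M N ext lvl else KA q M N ext lvl i

/-- the `μ`-weight space of a module. -/
def wtSp (q : ℂ) (M N : ℕ) (ext : Bool) {W : Type} [AddCommGroup W] [Module ℂ W]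
    [Module (ALG q M N ext 3) W] [IsScalarTower ℂ (ALG q M N ext 3) W] (μ : ℕ → ℂ) :
    Submodule ℂ W where
  carrier := {w | ∀ i < M + N, Kgen q M N ext 3 i • w = μ i • w}
  add_mem' := by
    intro a b ha hb i hi
    rw [smul_add, ha i hi, hb i hi, smul_add]
  zero_mem' := by
    intro i hi
    rw [smul_zero, smul_zero]
  smul_mem' := by
    intro c w hw i hi
    have h1 : Kgen q M N ext 3 i • (c • w) = c • (Kgen q M N ext 3 i • w) := by
      rw [← algebraMap_smul (ALG q M N ext 3) c w, ← mul_smul, ← Algebra.commutes, mul_smul,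
        algebraMap_smul]
    rw [h1, hw i hi, smul_comm]

/-- the character `λ_Λ`. -/
def lamF (q : ℂ) (M N : ℕ) (Λ : HW q M N) : ℕ → ℂ :=
  fun i => if i = 0 then 1 else if i = M then Λ.c else qpar q M i ^ (Λ.P i).natDegree

/-- the character `α_j`. -/
def alF (q : ℂ) (M : ℕ) (j : ℕ) : ℕ → ℂ :=
  fun i => if i = 0 then (if j = 1 then q else 1) else q ^ cc M j i

/-! ### The generators of `U` inside `U'` -/

def UGenSet (q : ℂ) (M N : ℕ) : Set (ALG q M N true 3) :=
  {x | (∃ i : ℕ, ∃ n : ℤ, x = XpA q M N true 3 i n) ∨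
    (∃ i : ℕ, ∃ n : ℤ, x = XmA q M N true 3 i n) ∨
    (∃ i : ℕ, x = KA q M N true 3 i) ∨ (∃ i : ℕ, x = KiA q M N true 3 i) ∨
    ∃ i : ℕ, ∃ s : ℤ, x = HA q M N true 3 i s}

/-! ### One-sided presentations (for `U^±`) -/

def XgF (M N : ℕ) (i : ℕ) (n : ℤ) : FreeAlgebra ℂ (Idx M N × ℤ) :=
  if h : 1 ≤ i ∧ i ≤ M + N - 1 then FreeAlgebra.ι ℂ ((⟨i, h⟩, n) : Idx M N × ℤ) else 0

inductive rel1 (q : ℂ) (M N : ℕ) (pl : Bool) :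
    FreeAlgebra ℂ (Idx M N × ℤ) → FreeAlgebra ℂ (Idx M N × ℤ) → Prop
  | comm0 (i j : Idx M N) (m n : ℤ) (h : cc M i.1 j.1 = 0) :
      rel1 q M N pl
        (FreeAlgebra.ι ℂ ((i, m) : Idx M N × ℤ) * FreeAlgebra.ι ℂ ((j, n) : Idx M N × ℤ) -
          sgn M i.1 j.1 •
            (FreeAlgebra.ι ℂ ((j, n) : Idx M N × ℤ) * FreeAlgebra.ι ℂ ((i, m) : Idx M N × ℤ))) 0
  | deg2 (i j : Idx M N) (m n : ℤ) (h : cc M i.1 j.1 ≠ 0) :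
      rel1 q M N pl
        (FreeAlgebra.ι ℂ ((i, m + 1) : Idx M N × ℤ) * FreeAlgebra.ι ℂ ((j, n) : Idx M N × ℤ) -
          (q ^ (if pl then cc M i.1 j.1 else -cc M i.1 j.1)) •
            (FreeAlgebra.ι ℂ ((j, n) : Idx M N × ℤ) *
              FreeAlgebra.ι ℂ ((i, m + 1) : Idx M N × ℤ)))
        ((q ^ (if pl then cc M i.1 j.1 else -cc M i.1 j.1)) •
            (FreeAlgebra.ι ℂ ((i, m) : Idx M N × ℤ) *
              FreeAlgebra.ι ℂ ((j, n + 1) : Idx M N × ℤ)) -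
          FreeAlgebra.ι ℂ ((j, n + 1) : Idx M N × ℤ) * FreeAlgebra.ι ℂ ((i, m) : Idx M N × ℤ))
  | serre (i j : Idx M N) (m n k : ℤ) (h : cc M i.1 j.1 = 1 ∨ cc M i.1 j.1 = -1)
      (hi : i.1 ≠ M) :
      rel1 q M N pl
        (brF q (FreeAlgebra.ι ℂ ((i, m) : Idx M N × ℤ))
            (brF q⁻¹ (FreeAlgebra.ι ℂ ((i, n) : Idx M N × ℤ))
              (FreeAlgebra.ι ℂ ((j, k) : Idx M N × ℤ))) +
          brF q (FreeAlgebra.ι ℂ ((i, n) : Idx M N × ℤ))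
            (brF q⁻¹ (FreeAlgebra.ι ℂ ((i, m) : Idx M N × ℤ))
              (FreeAlgebra.ι ℂ ((j, k) : Idx M N × ℤ)))) 0
  | osc (m n k u : ℤ) (hM : 1 < M) (hN : 1 < N) :
      rel1 q M N pl (oscOf q M (XgF M N) m n k u + oscOf q M (XgF M N) m u k n) 0

end QAS

namespace QAS

/-- the `μ`-weight space of the universal Weyl module `W(Λ)` over `U'`. -/
def wt18 (q : ℂ) (M N : ℕ) (Λ : HW q M N) (μ : ℕ → ℂ) :
    Submodule ℂ (UWeylMod q M N true Λ) :=
  wtSp q M N true μ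

end QAS

namespace QASX

set_option linter.unusedSectionVars false

section nil
variable {A : Type*} [Ring A] [Algebra ℂ A]

theorem span_pow_mono (F : A) {a b : ℕ} (h : a ≤ b) :
    Ideal.span {F ^ b} ≤ Ideal.span {F ^ a} := by
  rw [Ideal.span_singleton_le_iff_mem, Ideal.mem_span_singleton']
  exact ⟨F ^ (b - a), by rw [← pow_add]; congr 1; omega⟩

theorem smul_mem_ideal (I : Ideal A) (c : ℂ) {x : A} (hx : x ∈ I) : c • x ∈ I := by
  rw [Algebra.smul_def]; exact I.mul_mem_left _ hx

/-- elements `y` such that `F^a y ∈ A F^(a-d)` for some fixed defect `d`. -/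
def NF (F : A) : Subalgebra ℂ A where
  carrier := {y | ∃ d : ℕ, ∀ a : ℕ, F ^ a * y ∈ Ideal.span {F ^ (a - d)}}
  mul_mem' := by
    rintro y z ⟨d, hd⟩ ⟨e, he⟩
    refine ⟨d + e, fun a => ?_⟩
    obtain ⟨x, hx⟩ := Ideal.mem_span_singleton'.1 (hd a)
    rw [← mul_assoc, ← hx, mul_assoc, ← Nat.sub_sub]
    exact Ideal.mul_mem_left _ _ (he _)
  add_mem' := by
    rintro y z ⟨d, hd⟩ ⟨e, he⟩
    refine ⟨d + e, fun a => ?_⟩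
    rw [mul_add]
    exact add_mem (span_pow_mono F (by omega) (hd a)) (span_pow_mono F (by omega) (he a))
  algebraMap_mem' := by
    intro r
    refine ⟨0, fun a => ?_⟩
    rw [← Algebra.commutes]
    exact Ideal.mul_mem_left _ _ (Ideal.subset_span rfl)

theorem NF_self (F : A) : F ∈ NF F := by
  refine ⟨0, fun a => ?_⟩
  rw [← pow_succ, pow_succ']
  exact Ideal.mul_mem_left _ _ (Ideal.subset_span rfl)

theorem NF_of (F y r : A) (κ : ℂ) (h : F * y = κ • (y * F) + r) (hr : r ∈ NF F) : y ∈ NF F := by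
  obtain ⟨e, he⟩ := hr
  refine ⟨e + 1, fun a => ?_⟩
  induction a with
  | zero => simp
  | succ k ih =>
    rw [pow_succ, mul_assoc, h, mul_add, mul_smul_comm, ← mul_assoc]
    obtain ⟨x, hx⟩ := Ideal.mem_span_singleton'.1 ih
    refine add_mem (smul_mem_ideal _ _ ?_) (span_pow_mono F (by omega) (he k))
    rw [← hx, mul_assoc, ← pow_succ]
    exact Ideal.mul_mem_left _ _ (span_pow_mono F (by omega) (Ideal.subset_span rfl))

variable {V : Type*} [AddCommGroup V] [Module ℂ V] [Module A V] [IsScalarTower ℂ A V]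

theorem NF_nil (F y : A) (hy : y ∈ NF F) (v : V) (n : ℕ) (hv : F ^ n • v = 0) :
    ∃ m : ℕ, F ^ m • (y • v) = 0 := by
  obtain ⟨d, hd⟩ := hy
  refine ⟨n + d, ?_⟩
  obtain ⟨x, hx⟩ := Ideal.mem_span_singleton'.1 (hd (n + d))
  rw [smul_smul, ← hx, Nat.add_sub_cancel, mul_smul, hv, smul_zero]

theorem sc (a : A) (c : ℂ) (w : V) : a • (c • w) = c • (a • w) := by
  rw [← algebraMap_smul A c w, ← mul_smul, ← Algebra.commutes, mul_smul, algebraMap_smul]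

theorem smul_smul_c (a : A) (c : ℂ) (w : V) : (c • a) • w = c • (a • w) := smul_assoc c a w

/-- vectors killed by a power of `F` -/
def nilS (V : Type*) [AddCommGroup V] [Module ℂ V] [Module A V] [IsScalarTower ℂ A V]
    (F : A) : Submodule ℂ V where
  carrier := {w | ∃ m : ℕ, F ^ m • w = 0}
  add_mem' := by
    rintro a b ⟨m, hm⟩ ⟨n, hn⟩
    refine ⟨m + n, ?_⟩
    rw [smul_add, pow_add, mul_smul _ _ b, hn, smul_zero, add_zero, ← pow_add, add_comm, pow_add,
      mul_smul, hm, smul_zero]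
  zero_mem' := ⟨0, by simp⟩
  smul_mem' := by
    rintro c w ⟨m, hm⟩
    exact ⟨m, by rw [sc, hm, smul_zero]⟩

/-- stabilizer of a subspace -/
def stab (T : Submodule ℂ V) : Subalgebra ℂ A where
  carrier := {y | ∀ w ∈ T, y • w ∈ T}
  mul_mem' := by
    intro a b ha hb w hw
    rw [mul_smul]; exact ha _ (hb _ hw)
  add_mem' := by
    intro a b ha hb w hw
    rw [add_smul]; exact add_mem (ha _ hw) (hb _ hw)
  algebraMap_mem' := by
    intro r w hw
    rw [algebraMap_smul]; exact T.smul_mem _ hw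

end nil

section sl2
variable {V : Type*} [AddCommGroup V] [Module ℂ V]

open Polynomial in
theorem sl2_inj (p : ℂ) (hp0 : p ≠ 0) (hp1 : ∀ k : ℕ, k ≠ 0 → p ^ k ≠ 1)
    (E F K K' : Module.End ℂ V) (hKK' : K * K' = 1) (hK'K : K' * K = 1)
    (hKE : K * E = p ^ (2 : ℤ) • (E * K)) (hKF : K * F = p ^ (-2 : ℤ) • (F * K))
    (hEF : E * F - F * E = (p - p⁻¹)⁻¹ • (K - K'))
    (w : V) (m : ℕ) (hw : K w = p ^ (-(m : ℤ)) • w)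
    (hE : (E ^ m) w = 0) (t : ℕ) (hF : (F ^ t) w = 0) : w = 0 := by
  have hpp : p - p⁻¹ ≠ 0 := by
    intro h
    apply hp1 2 (by norm_num)
    field_simp at h
    linear_combination h
  have hzp : ∀ n : ℤ, p ^ n = 1 → n = 0 := by
    intro n hn
    by_contra h0
    apply hp1 n.natAbs (by omega)
    rcases Int.natAbs_eq n with h | h
    · rw [h, zpow_natCast] at hn; exact hn
    · rw [h, zpow_neg, inv_eq_one, zpow_natCast] at hn; exact hn
  have hK'E : K' * E = p ^ (-2 : ℤ) • (E * K') := by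
    have : K' * (K * E) * K' = K' * (p ^ (2 : ℤ) • (E * K)) * K' := by rw [hKE]
    rw [← mul_assoc, hK'K, one_mul, mul_smul_comm, smul_mul_assoc, mul_assoc, mul_assoc, hKK',
      mul_one] at this
    rw [this, smul_smul, ← zpow_add₀ hp0]; simp
  have hK'F : K' * F = p ^ (2 : ℤ) • (F * K') := by
    have : K' * (K * F) * K' = K' * (p ^ (-2 : ℤ) • (F * K)) * K' := by rw [hKF]
    rw [← mul_assoc, hK'K, one_mul, mul_smul_comm, smul_mul_assoc, mul_assoc, mul_assoc, hKK',
      mul_one] at this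
    rw [this, smul_smul, ← zpow_add₀ hp0]; simp
  set D : ℂ := ((p - p⁻¹) ^ 2)⁻¹ with hD
  have hDD : (p - p⁻¹)⁻¹ = D * (p - p⁻¹) := by rw [hD]; field_simp
  set C : Module.End ℂ V := F * E + D • (p • K + p⁻¹ • K') with hC
  have hEF' : E * F = F * E + (p - p⁻¹)⁻¹ • (K - K') := by rw [← hEF]; abel
  have hCF : C * F = F * C := by
    rw [hC, add_mul, mul_assoc, hEF', smul_mul_assoc, add_mul, smul_mul_assoc, smul_mul_assoc,
      hKF, hK'F, mul_add, mul_add, mul_smul_comm, mul_smul_comm, mul_sub, mul_add, mul_smul_comm,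
      mul_smul_comm, hDD]
    have h1 : p * p ^ (-2 : ℤ) = p⁻¹ := by
      rw [zpow_neg]; norm_cast; field_simp
    have h2 : p⁻¹ * p ^ (2 : ℤ) = p := by norm_cast; field_simp
    rw [smul_smul p, smul_smul p⁻¹, h1, h2]
    module
  have hCE : C * E = E * C := by
    rw [hC, mul_add, ← mul_assoc E, hEF']
    simp only [add_mul, smul_mul_assoc, sub_mul, hKE, hK'E, mul_smul_comm, mul_add, hDD]
    have h1 : p ^ (-2 : ℤ) = p⁻¹ * p⁻¹ := by
      rw [zpow_neg]; norm_cast; field_simp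
    have h2 : p ^ (2 : ℤ) = p * p := by norm_cast; field_simp
    rw [h1, h2]
    match_scalars <;> field_simp <;> ring
  have hKw : ∀ (x : V) (n : ℤ), K x = p ^ n • x → K' x = p ^ (-n) • x := by
    intro x n h
    have : K' (K x) = x := by
      have := congrArg (fun T : Module.End ℂ V => T x) hK'K
      simpa using this
    rw [h, map_smul] at this
    rw [← this, smul_smul, ← zpow_add₀ hp0, this]; simp
  let φ : ℤ → ℂ := fun n => D * (p ^ (n + 1) + p ^ (-(n + 1)))
  have hφ : ∀ a b : ℤ, φ a = φ b → a + 1 = b + 1 ∨ a + 1 = -(b + 1) := by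
    intro a b h
    have hD0 : D ≠ 0 := by rw [hD]; positivity
    have h1 := mul_left_cancel₀ hD0 h
    have ha := zpow_ne_zero (a + 1) hp0
    have hb := zpow_ne_zero (b + 1) hp0
    rw [zpow_neg, zpow_neg] at h1
    have h2 : (p ^ (a + 1) - p ^ (b + 1)) * (p ^ (a + 1) * p ^ (b + 1) - 1) = 0 := by
      field_simp at h1
      linear_combination h1
    rcases mul_eq_zero.1 h2 with h3 | h3
    · left
      have : p ^ ((a + 1) - (b + 1)) = 1 := by
        rw [zpow_sub₀ hp0, sub_eq_zero.1 h3, div_self hb]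
      have := hzp _ this
      omega
    · right
      have : p ^ ((a + 1) + (b + 1)) = 1 := by
        rw [zpow_add₀ hp0, sub_eq_zero.1 h3]
      have := hzp _ this
      omega
  have hFEx : ∀ (x : V) (n : ℤ), K x = p ^ n • x → F (E x) = C x - φ n • x := by
    intro x n h
    have : C x = F (E x) + D • (p • K x + p⁻¹ • K' x) := by
      simp [hC]
    rw [this, h, hKw x n h]
    simp only [φ]
    rw [zpow_neg, zpow_neg, zpow_add_one₀ hp0, mul_inv]
    module
  have hEFx : ∀ (x : V) (n : ℤ), K x = p ^ n • x → E (F x) = C x - φ (n - 2) • x := by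
    intro x n h
    have h1 : E (F x) = F (E x) + (p - p⁻¹)⁻¹ • (K x - K' x) := by
      have := congrArg (fun T : Module.End ℂ V => T x) hEF'
      simpa using this
    rw [h1, hFEx x n h, h, hKw x n h, hDD]
    simp only [φ]
    have e : n - 2 + 1 = n - 1 := by ring
    rw [e, zpow_neg, zpow_neg, zpow_neg, zpow_sub_one₀ hp0, zpow_add_one₀ hp0, mul_inv, mul_inv, inv_inv]
    module
  have hKEk : ∀ k : ℕ, K ((E ^ k) w) = p ^ (-(m : ℤ) + 2 * k) • (E ^ k) w := by
    intro k
    induction k with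
    | zero => simpa using hw
    | succ k ih =>
      have := congrArg (fun T : Module.End ℂ V => T ((E ^ k) w)) hKE
      simp only [Module.End.mul_apply, LinearMap.smul_apply] at this
      rw [pow_succ', Module.End.mul_apply, this, ih, map_smul, smul_smul, ← zpow_add₀ hp0]
      congr 2; push_cast; ring
  have hKFk : ∀ k : ℕ, K ((F ^ k) w) = p ^ (-(m : ℤ) - 2 * k) • (F ^ k) w := by
    intro k
    induction k with
    | zero => simpa using hw
    | succ k ih =>
      have := congrArg (fun T : Module.End ℂ V => T ((F ^ k) w)) hKF
      simp only [Module.End.mul_apply, LinearMap.smul_apply] at this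
      rw [pow_succ', Module.End.mul_apply, this, ih, map_smul, smul_smul, ← zpow_add₀ hp0]
      congr 2; push_cast; ring
  have hCFk : ∀ k : ℕ, ∀ x, (F ^ k) (C x) = C ((F ^ k) x) := by
    intro k x
    have : F ^ k * C = C * F ^ k := ((show Commute F C from hCF.symm).pow_left k).eq
    exact congrArg (fun T : Module.End ℂ V => T x) this
  have hCEk : ∀ k : ℕ, ∀ x, (E ^ k) (C x) = C ((E ^ k) x) := by
    intro k x
    have : E ^ k * C = C * E ^ k := ((show Commute E C from hCE.symm).pow_left k).eq
    exact congrArg (fun T : Module.End ℂ V => T x) this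
  have hA : ∀ k : ℕ, (F ^ k) ((E ^ k) w) =
      aeval C (∏ j ∈ Finset.range k, (X - Polynomial.C (φ (-(m : ℤ) + 2 * j)))) w := by
    intro k
    induction k with
    | zero => simp
    | succ k ih =>
      rw [pow_succ, pow_succ' E, Module.End.mul_apply, Module.End.mul_apply,
        hFEx _ _ (hKEk k), map_sub, hCFk, map_smul, ih, Finset.prod_range_succ, mul_comm (Finset.prod _ _),
        map_mul, Module.End.mul_apply, map_sub, aeval_X, aeval_C]
      simp
  have hB : ∀ k : ℕ, (E ^ k) ((F ^ k) w) =
      aeval C (∏ j ∈ Finset.range k, (X - Polynomial.C (φ (-(m : ℤ) - 2 * j - 2)))) w := by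
    intro k
    induction k with
    | zero => simp
    | succ k ih =>
      rw [pow_succ, pow_succ' F, Module.End.mul_apply, Module.End.mul_apply,
        hEFx _ _ (hKFk k), map_sub, hCEk, map_smul, ih, Finset.prod_range_succ, mul_comm (Finset.prod _ _),
        map_mul, Module.End.mul_apply, map_sub, aeval_X, aeval_C]
      simp
  have hcop : IsCoprime (∏ j ∈ Finset.range m, (X - Polynomial.C (φ (-(m : ℤ) + 2 * j))))
      (∏ j ∈ Finset.range t, (X - Polynomial.C (φ (-(m : ℤ) - 2 * j - 2)))) := by
    refine IsCoprime.prod_left fun i hi => IsCoprime.prod_right fun j hj => ?_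
    refine isCoprime_X_sub_C_of_isUnit_sub ?_
    rw [isUnit_iff_ne_zero, sub_ne_zero]
    intro h
    have := Finset.mem_range.1 hi
    rcases hφ _ _ h with h | h <;> omega
  obtain ⟨a, b, hab⟩ := hcop
  have h1 := hA m
  rw [hE, map_zero] at h1
  have h2 := hB t
  rw [hF, map_zero] at h2
  have h3 := congrArg (fun P => aeval C P w) hab
  simp only [map_add, map_mul, LinearMap.add_apply, Module.End.mul_apply, ← h1, ← h2, map_zero,
    map_one, Module.End.one_apply, add_zero] at h3
  exact h3.symm
end sl2
end QASX

namespace QASX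

theorem joint_weight {V : Type*} [AddCommGroup V] [Module ℂ V] {ι U : Type*}
    (f : ι → Module.End ℂ V) (hf : ∀ i j, Commute (f i) (f j))
    (W : U → Submodule ℂ V) (χ : U → ι → ℂ) (hW : ∀ u, ∀ w ∈ W u, ∀ i, f i w = χ u i • w)
    (htop : ⨆ u, W u = ⊤) (μ : ι → ℂ) (w : V) (hw : w ≠ 0) (hμ : ∀ i, f i w = μ i • w) :
    ∃ u, W u ≠ ⊥ ∧ χ u = μ := by
  by_contra hcon
  push Not at hcon
  have hind := Module.End.independent_iInf_maxGenEigenspace_of_forall_mapsTo f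
    (fun i j φ => Module.End.mapsTo_maxGenEigenspace_of_comm (hf j i) φ)
  have hd := hind μ
  have hmem : ∀ (ν : ι → ℂ) (x : V), (∀ i, f i x = ν i • x) →
      x ∈ ⨅ i, (f i).maxGenEigenspace (ν i) := by
    intro ν x hx
    rw [Submodule.mem_iInf]
    intro i
    rw [Module.End.mem_maxGenEigenspace]
    exact ⟨1, by simp [hx i]⟩
  have hle : (⊤ : Submodule ℂ V) ≤ ⨆ ν, ⨆ (_ : ν ≠ μ), ⨅ i, (f i).maxGenEigenspace (ν i) := by
    rw [← htop]
    refine iSup_le fun u => ?_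
    by_cases hu : W u = ⊥
    · rw [hu]; exact bot_le
    · intro x hx
      have : (⨅ i, (f i).maxGenEigenspace (χ u i)) ≤
          ⨆ ν, ⨆ (_ : ν ≠ μ), ⨅ i, (f i).maxGenEigenspace (ν i) :=
        le_iSup₂_of_le (χ u) (hcon u hu) le_rfl
      exact this (hmem _ _ (hW u x hx))
  have := Submodule.disjoint_def.1 hd w (hmem μ w hμ) (hle trivial)
  exact hw this

theorem tele (t : ℕ → ℤ) (i n : ℕ) :
    ∑ j ∈ Finset.Icc (i + 1) (i + n), (t (j - 1) - t j) = t i - t (i + n) := by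
  induction n with
  | zero => simp
  | succ n ih =>
    rw [← Nat.add_assoc, Finset.sum_Icc_succ_top (by omega), ih]
    simp

theorem comb_key (L : ℕ) (a d : ℕ → ℤ) (had : ∀ j, 1 ≤ j → j < L → a j - a (j + 1) = d j)
    (S : Set (ℕ → ℤ)) (h0 : ∀ t ∈ S, t 0 = 0) (hnn : ∀ t ∈ S, ∀ j, 0 ≤ t j)
    (hr : ∀ t ∈ S, ∀ j, 1 ≤ j → j < L → d j + t (j - 1) + t (j + 1) - 2 * t j < 0 →
      Function.update t j (d j + t (j - 1) + t (j + 1) - t j) ∈ S) (s : ℕ) :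
    ∀ J : Finset ℕ, J ⊆ Finset.Icc 1 L → ∑ j ∈ J, j ≤ s → ∀ t ∈ S,
      ∑ j ∈ J, (t (j - 1) - t j + a j) ≤ ∑ j ∈ Finset.Icc 1 J.card, a j := by
  induction s with
  | zero =>
    intro J hJ hs t ht
    have : J = ∅ := by
      rw [Finset.eq_empty_iff_forall_notMem]
      intro j hj
      have h1 := Finset.single_le_sum (f := fun j : ℕ => j) (fun _ _ => Nat.zero_le _) hj
      have h2 := Finset.mem_Icc.1 (hJ hj)
      omega
    subst this
    simp
  | succ s ih =>
    intro J hJ hs t ht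
    by_cases hex : ∃ r, r + 1 ∈ J ∧ 1 ≤ r ∧ r ∉ J
    · obtain ⟨r, hrJ, hr1, hrn⟩ := hex
      have hrL := (Finset.mem_Icc.1 (hJ hrJ)).2
      have hne : r ∉ J.erase (r + 1) := fun h => hrn (Finset.mem_of_mem_erase h)
      have hsub : insert r (J.erase (r + 1)) ⊆ Finset.Icc 1 L := by
        intro j hj
        rcases Finset.mem_insert.1 hj with rfl | h
        · rw [Finset.mem_Icc]; omega
        · exact hJ (Finset.mem_of_mem_erase h)
      have hcard : (insert r (J.erase (r + 1))).card = J.card := by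
        rw [Finset.card_insert_of_notMem hne, Finset.card_erase_add_one hrJ]
      have hsum : ∑ j ∈ insert r (J.erase (r + 1)), j ≤ s := by
        rw [Finset.sum_insert hne]
        have := Finset.add_sum_erase J (fun j => j) hrJ
        omega
      have had' := had r hr1 (by omega)
      have hJs := Finset.add_sum_erase J (fun j => t (j - 1) - t j + a j) hrJ
      simp only [Nat.add_sub_cancel] at hJs
      by_cases hneg : d r + t (r - 1) + t (r + 1) - 2 * t r < 0
      · have := ih _ hsub hsum _ (hr t ht r hr1 (by omega) hneg)
        rw [hcard, Finset.sum_insert hne] at this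
        have e : ∑ j ∈ J.erase (r + 1),
            (Function.update t r (d r + t (r - 1) + t (r + 1) - t r) (j - 1) -
              Function.update t r (d r + t (r - 1) + t (r + 1) - t r) j + a j) =
            ∑ j ∈ J.erase (r + 1), (t (j - 1) - t j + a j) := by
          refine Finset.sum_congr rfl fun j hj => ?_
          have h1 : j ≠ r := by rintro rfl; exact hne hj
          have h2 : j ≠ r + 1 := (Finset.mem_erase.1 hj).1
          have h3 := (Finset.mem_Icc.1 (hJ (Finset.mem_of_mem_erase hj))).1
          rw [Function.update_of_ne h1, Function.update_of_ne (by omega)]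
        rw [e, Function.update_self, Function.update_of_ne (by omega)] at this
        linarith
      · have := ih _ hsub hsum _ ht
        rw [hcard, Finset.sum_insert hne] at this
        linarith
    · push Not at hex
      have hdown : ∀ k j, j + k ∈ J → 1 ≤ j → j ∈ J := by
        intro k
        induction k with
        | zero => intro j h _; exact h
        | succ k ihk => intro j h hj; exact ihk j (hex (j + k) h (by omega)) hj
      rcases J.eq_empty_or_nonempty with rfl | hJn
      · simp
      · have hJe : J = Finset.Icc 1 (J.max' hJn) := by
          ext j
          rw [Finset.mem_Icc]
          constructor
          · intro h; exact ⟨(Finset.mem_Icc.1 (hJ h)).1, J.le_max' _ h⟩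
          · rintro ⟨h1, h2⟩
            refine hdown (J.max' hJn - j) j ?_ h1
            rw [Nat.add_sub_of_le h2]; exact J.max'_mem hJn
        generalize J.max' hJn = m at hJe
        subst hJe
        rw [Nat.card_Icc, Finset.sum_add_distrib]
        have := tele t 0 m
        simp only [zero_add] at this
        rw [this, h0 t ht]
        have := hnn t ht m
        simp only [Nat.add_sub_cancel]
        linarith

theorem comb (L : ℕ) (d : ℕ → ℤ) : ∃ B : ℤ, ∀ S : Set (ℕ → ℤ),
    (∀ t ∈ S, t 0 = 0) → (∀ t ∈ S, ∀ j, 0 ≤ t j) →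
    (∀ t ∈ S, ∀ j, 1 ≤ j → j < L → d j + t (j - 1) + t (j + 1) - 2 * t j < 0 →
      Function.update t j (d j + t (j - 1) + t (j + 1) - t j) ∈ S) →
    ∀ t ∈ S, ∀ i ≤ L, t i - t L ≤ B := by
  let a : ℕ → ℤ := fun j => ∑ k ∈ Finset.Ico j L, d k
  have had : ∀ j, 1 ≤ j → j < L → a j - a (j + 1) = d j := by
    intro j _ hj
    simp only [a]
    rw [Finset.sum_eq_sum_Ico_succ_bot hj]; ring
  let g : ℕ → ℤ := fun i => ∑ j ∈ Finset.Icc 1 (L - i), a j - ∑ j ∈ Finset.Icc (i + 1) L, a j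
  refine ⟨∑ i ∈ Finset.range (L + 1), |g i|, ?_⟩
  intro S h0 hnn hr t ht i hi
  have h1 := comb_key L a d had S h0 hnn hr _ (Finset.Icc (i + 1) L)
    (Finset.Icc_subset_Icc_left (by omega)) le_rfl t ht
  rw [Finset.sum_add_distrib, Nat.card_Icc] at h1
  have h2 := tele t i (L - i)
  rw [Nat.add_sub_of_le hi] at h2
  rw [h2] at h1
  have h3 : |g i| ≤ ∑ i ∈ Finset.range (L + 1), |g i| :=
    Finset.single_le_sum (f := fun i => |g i|) (fun _ _ => abs_nonneg _)
      (Finset.mem_range.2 (by omega))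
  have h4 := le_abs_self (g i)
  have e : L + 1 - (i + 1) = L - i := by omega
  rw [e] at h1
  simp only [g] at h3 h4
  linarith

end QASX

namespace QASX
open QAS

/-- image of a generator in the extended algebra -/
def gA (q : ℂ) (M N : ℕ) (x : Gen M N true) : ALG q M N true 3 := mkA q M N true 3 (gi x)

theorem relA {q : ℂ} {M N : ℕ} {x y : FA M N true} (h : rel q M N true 3 x y) :
    mkA q M N true 3 x = mkA q M N true 3 y := RingQuot.mkAlgHom_rel ℂ h

theorem gen_top {q : ℂ} {M N : ℕ} (S : Subalgebra ℂ (ALG q M N true 3))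
    (h : ∀ x, gA q M N x ∈ S) (y : ALG q M N true 3) : y ∈ S := by
  obtain ⟨f, rfl⟩ := RingQuot.mkAlgHom_surjective ℂ (rel q M N true 3) y
  have : f ∈ S.comap (mkA q M N true 3) := by
    have h1 : (⊤ : Subalgebra ℂ (FA M N true)) ≤ S.comap (mkA q M N true 3) := by
      rw [← FreeAlgebra.adjoin_range_ι, Algebra.adjoin_le_iff]
      rintro _ ⟨x, rfl⟩
      exact h x
    exact h1 trivial
  exact this

theorem XmA_eq {q : ℂ} {M N : ℕ} (i : Idx M N) (n : ℤ) :
    XmA q M N true 3 i.1 n = gA q M N (Gen.Xm i n) := by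
  unfold XmA XmF gA; rw [dif_pos i.2]

theorem XpA_eq {q : ℂ} {M N : ℕ} (i : Idx M N) (n : ℤ) :
    XpA q M N true 3 i.1 n = gA q M N (Gen.Xp i n) := by
  unfold XpA XpF gA; rw [dif_pos i.2]

theorem KA_eq {q : ℂ} {M N : ℕ} (i : Idx M N) :
    KA q M N true 3 i.1 = gA q M N (Gen.K i) := by
  unfold KA KF gA; rw [dif_pos i.2]

theorem K0A_eq {q : ℂ} {M N : ℕ} :
    K0A q M N true 3 = gA q M N (Gen.K0 rfl) := by
  unfold K0A K0F gA; rw [dif_pos rfl]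

variable {q : ℂ} {M N : ℕ}

theorem expC_mem {A : Type} [Ring A] [Algebra ℂ A] (S : Subalgebra ℂ A) (t : ℂ) (a : ℕ → A)
    (h : ∀ s, a s ∈ S) (n : ℕ) : expC t a n ∈ S := by
  induction n using Nat.strong_induction_on with
  | _ n ih =>
    cases n with
    | zero => rw [expC]; exact S.one_mem
    | succ n =>
      rw [expC]
      refine S.smul_mem (S.smul_mem (S.sum_mem fun s _ => S.smul_mem (S.mul_mem (h _) ?_) _) _) _
      exact ih _ (by omega)

theorem HF_mem (S : Subalgebra ℂ (ALG q M N true 3))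
    (hH : ∀ i s, gA q M N (Gen.H i s) ∈ S) (i : ℕ) (s : ℤ) :
    HF M N true i s ∈ S.comap (mkA q M N true 3) := by
  unfold HF
  split_ifs with h
  · exact hH _ _
  · exact Subalgebra.zero_mem _

theorem phiP_mem (S : Subalgebra ℂ (ALG q M N true 3)) (hK : ∀ i, gA q M N (Gen.K i) ∈ S)
    (hH : ∀ i s, gA q M N (Gen.H i s) ∈ S) (i : Idx M N) (n : ℤ) :
    mkA q M N true 3 (phiPF q M N true i.1 n) ∈ S := by
  unfold phiPF
  split_ifs
  · rw [map_mul]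
    refine S.mul_mem (by unfold KF; rw [dif_pos i.2]; exact hK i) ?_
    exact expC_mem (S.comap (mkA q M N true 3)) _ _ (fun s => HF_mem S hH _ _) _
  · rw [map_zero]; exact S.zero_mem

theorem phiM_mem (S : Subalgebra ℂ (ALG q M N true 3)) (hK : ∀ i, gA q M N (Gen.Ki i) ∈ S)
    (hH : ∀ i s, gA q M N (Gen.H i s) ∈ S) (i : Idx M N) (n : ℤ) :
    mkA q M N true 3 (phiMF q M N true i.1 n) ∈ S := by
  unfold phiMF
  split_ifs
  · rw [map_mul]
    refine S.mul_mem (by unfold KiF; rw [dif_pos i.2]; exact hK i) ?_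
    exact expC_mem (S.comap (mkA q M N true 3)) _ _ (fun s => HF_mem S hH _ _) _
  · rw [map_zero]; exact S.zero_mem

/-! relations in the extended algebra -/

theorem a_KKi (i : Idx M N) : gA q M N (Gen.K i) * gA q M N (Gen.Ki i) = 1 := by
  have := relA (rel.KKi (q := q) (lvl := 3) (ext := true) i)
  simpa only [gA, map_mul, map_one] using this

theorem a_KiK (i : Idx M N) : gA q M N (Gen.Ki i) * gA q M N (Gen.K i) = 1 := by
  have := relA (rel.KiK (q := q) (lvl := 3) (ext := true) i)
  simpa only [gA, map_mul, map_one] using this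

theorem a_K0K0i : gA q M N (Gen.K0 rfl) * gA q M N (Gen.K0i rfl) = 1 := by
  have := relA (rel.K0K0i (q := q) (M := M) (N := N) (lvl := 3) rfl)
  simpa only [gA, map_mul, map_one] using this

theorem a_K0iK0 : gA q M N (Gen.K0i rfl) * gA q M N (Gen.K0 rfl) = 1 := by
  have := relA (rel.K0iK0 (q := q) (M := M) (N := N) (lvl := 3) rfl)
  simpa only [gA, map_mul, map_one] using this

theorem a_KXp (i j : Idx M N) (n : ℤ) : gA q M N (Gen.K i) * gA q M N (Gen.Xp j n) =
    (q ^ cc M i.1 j.1) • (gA q M N (Gen.Xp j n) * gA q M N (Gen.K i)) := by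
  have := relA (rel.KXp (q := q) (lvl := 3) (ext := true) i j n)
  simpa only [gA, map_mul, map_smul] using this

theorem a_KXm (i j : Idx M N) (n : ℤ) : gA q M N (Gen.K i) * gA q M N (Gen.Xm j n) =
    (q ^ (-cc M i.1 j.1)) • (gA q M N (Gen.Xm j n) * gA q M N (Gen.K i)) := by
  have := relA (rel.KXm (q := q) (lvl := 3) (ext := true) i j n)
  simpa only [gA, map_mul, map_smul] using this

theorem a_K0Xp (j : Idx M N) (n : ℤ) : gA q M N (Gen.K0 rfl) * gA q M N (Gen.Xp j n) =
    (q ^ (if j.1 = 1 then (1 : ℤ) else 0)) • (gA q M N (Gen.Xp j n) * gA q M N (Gen.K0 rfl)) := by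
  have := relA (rel.K0Xp (q := q) (lvl := 3) rfl j n)
  simpa only [gA, map_mul, map_smul] using this

theorem a_K0Xm (j : Idx M N) (n : ℤ) : gA q M N (Gen.K0 rfl) * gA q M N (Gen.Xm j n) =
    (q ^ (if j.1 = 1 then (-1 : ℤ) else 0)) • (gA q M N (Gen.Xm j n) * gA q M N (Gen.K0 rfl)) := by
  have := relA (rel.K0Xm (q := q) (lvl := 3) rfl j n)
  simpa only [gA, map_mul, map_smul] using this

theorem a_HXp (i j : Idx M N) (s : {s : ℤ // s ≠ 0}) (n : ℤ) :
    gA q M N (Gen.H i s) * gA q M N (Gen.Xp j n) - gA q M N (Gen.Xp j n) * gA q M N (Gen.H i s) =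
        ((qint (qpar q M i.1) (s.1 * lof M i.1 * cc M i.1 j.1) / (s.1 : ℂ)) •
          gA q M N (Gen.Xp j (n + s.1))) := by
  have := relA (rel.HXp (q := q) (lvl := 3) (ext := true) i j s n)
  simpa only [gA, map_mul, map_smul, map_sub] using this

theorem a_HXm (i j : Idx M N) (s : {s : ℤ // s ≠ 0}) (n : ℤ) :
    gA q M N (Gen.H i s) * gA q M N (Gen.Xm j n) - gA q M N (Gen.Xm j n) * gA q M N (Gen.H i s) =
        -((qint (qpar q M i.1) (s.1 * lof M i.1 * cc M i.1 j.1) / (s.1 : ℂ)) •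
          gA q M N (Gen.Xm j (n + s.1))) := by
  have := relA (rel.HXm (q := q) (lvl := 3) (ext := true) i j s n)
  simpa only [gA, map_mul, map_smul, map_sub, map_neg] using this

theorem a_XpXm (i j : Idx M N) (m n : ℤ) :
    gA q M N (Gen.Xp i m) * gA q M N (Gen.Xm j n) -
          sgn M i.1 j.1 • (gA q M N (Gen.Xm j n) * gA q M N (Gen.Xp i m)) =
        (if i = j then
            (qpar q M i.1 - (qpar q M i.1)⁻¹)⁻¹ •
              (mkA q M N true 3 (phiPF q M N true i.1 (m + n)) -
                mkA q M N true 3 (phiMF q M N true i.1 (m + n)))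
          else 0) := by
  have := relA (rel.XpXm (q := q) (lvl := 3) (ext := true) i j m n)
  split_ifs at this ⊢ <;>
  simpa only [gA, map_mul, map_smul, map_sub, map_zero] using this

theorem a_XX0m (i j : Idx M N) (m n : ℤ) (h : cc M i.1 j.1 = 0) :
    gA q M N (Gen.Xm i m) * gA q M N (Gen.Xm j n) =
      sgn M i.1 j.1 • (gA q M N (Gen.Xm j n) * gA q M N (Gen.Xm i m)) := by
  have := relA (rel.XX0m (q := q) (lvl := 3) (ext := true) i j m n (by norm_num) h)
  rw [← sub_eq_zero]
  simpa only [gA, map_mul, map_smul, map_sub, map_zero] using this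

theorem a_XX0p (i j : Idx M N) (m n : ℤ) (h : cc M i.1 j.1 = 0) :
    gA q M N (Gen.Xp i m) * gA q M N (Gen.Xp j n) =
      sgn M i.1 j.1 • (gA q M N (Gen.Xp j n) * gA q M N (Gen.Xp i m)) := by
  have := relA (rel.XX0p (q := q) (lvl := 3) (ext := true) i j m n (by norm_num) h)
  rw [← sub_eq_zero]
  simpa only [gA, map_mul, map_smul, map_sub, map_zero] using this

theorem a_XXm (i j : Idx M N) (m n : ℤ) (h : cc M i.1 j.1 ≠ 0) :
    gA q M N (Gen.Xm i (m + 1)) * gA q M N (Gen.Xm j n) -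
          (q ^ (-cc M i.1 j.1)) • (gA q M N (Gen.Xm j n) * gA q M N (Gen.Xm i (m + 1))) =
        ((q ^ (-cc M i.1 j.1)) • (gA q M N (Gen.Xm i m) * gA q M N (Gen.Xm j (n + 1))) -
          gA q M N (Gen.Xm j (n + 1)) * gA q M N (Gen.Xm i m)) := by
  have := relA (rel.XXm (q := q) (lvl := 3) (ext := true) i j m n (by norm_num) h)
  simpa only [gA, map_mul, map_smul, map_sub] using this

theorem a_serreM (i j : Idx M N) (k : ℤ)
    (h : cc M i.1 j.1 = 1 ∨ cc M i.1 j.1 = -1) (hi : i.1 ≠ M) :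
    brF q (gA q M N (Gen.Xm i 0)) (brF q⁻¹ (gA q M N (Gen.Xm i 0)) (gA q M N (Gen.Xm j k))) = 0 := by
  have := relA (rel.serreM (q := q) (lvl := 3) (ext := true) i j 0 0 k (by norm_num) h hi)
  rw [map_add, map_zero, ← two_smul ℂ, smul_eq_zero] at this
  have h2 := this.resolve_left (by norm_num)
  simpa only [gA, brF, map_mul, map_smul, map_sub] using h2

/-- conjugation by an invertible element -/
theorem inv_comm {A : Type*} [Ring A] [Algebra ℂ A] (K K' x : A) (h1 : K * K' = 1) (h2 : K' * K = 1)
    (c : ℂ) (hc : c ≠ 0) (h : K * x = c • (x * K)) : K' * x = c⁻¹ • (x * K') := by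
  have : K' * (K * x) * K' = K' * (c • (x * K)) * K' := by rw [h]
  rw [← mul_assoc, h2, one_mul, mul_smul_comm, smul_mul_assoc, mul_assoc, mul_assoc, h1,
    mul_one] at this
  rw [this, smul_smul, inv_mul_cancel₀ hc, one_smul]

theorem flip_c {A : Type*} [Ring A] [Algebra ℂ A] (K x : A)
    (c : ℂ) (hc : c ≠ 0) (h : K * x = c • (x * K)) : x * K = c⁻¹ • (K * x) := by
  rw [h, smul_smul, inv_mul_cancel₀ hc, one_smul]

theorem cc_cases (i j : ℕ) :
    i = j ∨ cc M i j = 0 ∨ cc M i j = 1 ∨ cc M i j = -1 := by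
  unfold cc form4 innerE lof
  split_ifs <;> omega

theorem cc_self (i : ℕ) (hi : i ≠ M) : cc M i i ≠ 0 := by
  unfold cc form4 innerE lof
  split_ifs <;> omega

theorem NF_of0 {A : Type*} [Ring A] [Algebra ℂ A] (F y : A) (κ : ℂ) (h : F * y = κ • (y * F)) :
    y ∈ NF F :=
  NF_of F y 0 κ (by rw [h, add_zero]) (Subalgebra.zero_mem _)

theorem NF_Xm_self (hq0 : q ≠ 0) (i : Idx M N) (hi : i.1 ≠ M) (n : ℤ) :
    gA q M N (Gen.Xm i n) ∈ NF (gA q M N (Gen.Xm i 0)) := by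
  have hc := cc_self i.1 hi
  set κ := q ^ (-cc M i.1 i.1) with hκ
  have hκ0 : κ ≠ 0 := zpow_ne_zero _ hq0
  have hrel : ∀ m n : ℤ, gA q M N (Gen.Xm i (m + 1)) * gA q M N (Gen.Xm i n) -
          κ • (gA q M N (Gen.Xm i n) * gA q M N (Gen.Xm i (m + 1))) =
        (κ • (gA q M N (Gen.Xm i m) * gA q M N (Gen.Xm i (n + 1))) -
          gA q M N (Gen.Xm i (n + 1)) * gA q M N (Gen.Xm i m)) := fun m n => a_XXm i i m n hc
  have hpos : ∀ n : ℕ, gA q M N (Gen.Xm i n) ∈ NF (gA q M N (Gen.Xm i 0)) := by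
    intro n
    induction n using Nat.strong_induction_on with
    | _ n ih =>
      rcases n with _ | _ | n
      · exact NF_self _
      · have h := hrel 0 0
        simp only [zero_add] at h
        refine NF_of _ _ 0 κ⁻¹ ?_ (Subalgebra.zero_mem _)
        have h2 : (2 : ℂ) • (gA q M N (Gen.Xm i 1) * gA q M N (Gen.Xm i 0)) =
            (2 : ℂ) • (κ • (gA q M N (Gen.Xm i 0) * gA q M N (Gen.Xm i 1))) := by
          rw [two_smul, two_smul]
          have := sub_eq_iff_eq_add.1 h
          nth_rewrite 1 [this]
          abel
        have h3 := smul_right_injective _ (two_ne_zero (α := ℂ)) h2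
        push_cast
        rw [h3, smul_smul, inv_mul_cancel₀ hκ0, one_smul, add_zero]
      · have h := hrel (n + 1) 0
        have e : (n : ℤ) + 1 + 1 = ((n + 1 + 1 : ℕ) : ℤ) := by push_cast; ring
        have e' : (n : ℤ) + 1 = ((n + 1 : ℕ) : ℤ) := by push_cast; ring
        rw [e, e', zero_add] at h
        have h1 : gA q M N (Gen.Xm i 1) ∈ NF (gA q M N (Gen.Xm i 0)) := by
          have := ih 1 (by omega); simpa using this
        have h2 := ih (n + 1) (by omega)
        refine NF_of _ _ (κ⁻¹ • (gA q M N (Gen.Xm i 1) * gA q M N (Gen.Xm i (n + 1 : ℕ))) -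
          gA q M N (Gen.Xm i (n + 1 : ℕ)) * gA q M N (Gen.Xm i 1)) κ⁻¹ ?_ ?_
        · rw [sub_eq_iff_eq_add] at h
          rw [h, smul_add, smul_sub, smul_smul, smul_smul, inv_mul_cancel₀ hκ0, one_smul, one_smul]
          abel
        · exact sub_mem (Subalgebra.smul_mem _ (mul_mem h1 h2) _) (mul_mem h2 h1)
  have hneg : ∀ n : ℕ, gA q M N (Gen.Xm i (-(n : ℤ))) ∈ NF (gA q M N (Gen.Xm i 0)) := by
    intro n
    induction n using Nat.strong_induction_on with
    | _ n ih =>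
      rcases n with _ | _ | n
      · simpa using NF_self _
      · have h := hrel (-1) (-1)
        simp only [neg_add_cancel] at h
        refine NF_of _ _ 0 κ ?_ (Subalgebra.zero_mem _)
        have h2 : (2 : ℂ) • (gA q M N (Gen.Xm i 0) * gA q M N (Gen.Xm i (-1))) =
            (2 : ℂ) • (κ • (gA q M N (Gen.Xm i (-1)) * gA q M N (Gen.Xm i 0))) := by
          rw [two_smul, two_smul]
          have := sub_eq_iff_eq_add.1 h
          nth_rewrite 1 [this]
          abel
        have h3 := smul_right_injective _ (two_ne_zero (α := ℂ)) h2
        push_cast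
        rw [h3, add_zero]
      · have h := hrel (-1) (-((n + 1 + 1 : ℕ) : ℤ))
        have e' : -((n + 1 + 1 : ℕ) : ℤ) + 1 = -((n + 1 : ℕ) : ℤ) := by push_cast; ring
        rw [e', neg_add_cancel] at h
        have h1 : gA q M N (Gen.Xm i (-1)) ∈ NF (gA q M N (Gen.Xm i 0)) := by
          have := ih 1 (by omega); simpa using this
        have h2 := ih (n + 1) (by omega)
        refine NF_of _ _ (κ • (gA q M N (Gen.Xm i (-1)) * gA q M N (Gen.Xm i (-((n + 1 : ℕ) : ℤ)))) -
          gA q M N (Gen.Xm i (-((n + 1 : ℕ) : ℤ))) * gA q M N (Gen.Xm i (-1))) κ ?_ ?_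
        · rw [sub_eq_iff_eq_add] at h
          rw [h]; abel
        · exact sub_mem (Subalgebra.smul_mem _ (mul_mem h1 h2) _) (mul_mem h2 h1)
  rcases Int.eq_nat_or_neg n with ⟨k, rfl | rfl⟩
  · exact hpos k
  · exact hneg k

theorem NF_Xm (hq0 : q ≠ 0) (i j : Idx M N) (hi : i.1 ≠ M) (n : ℤ) :
    gA q M N (Gen.Xm j n) ∈ NF (gA q M N (Gen.Xm i 0)) := by
  rcases cc_cases (M := M) i.1 j.1 with h | h | h
  · rw [← Subtype.ext h]; exact NF_Xm_self hq0 i hi n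
  · exact NF_of0 _ _ _ (a_XX0m i j 0 n h)
  · have hs := a_serreM (q := q) i j n h hi
    set F := gA q M N (Gen.Xm i 0)
    set y := gA q M N (Gen.Xm j n)
    have h1 : brF q⁻¹ F y ∈ NF F := by
      refine NF_of _ _ 0 q ?_ (Subalgebra.zero_mem _)
      rw [add_zero, ← sub_eq_zero]
      exact hs
    refine NF_of _ _ _ q⁻¹ ?_ h1
    unfold brF; abel

theorem NF_zero (hq0 : q ≠ 0) (i : Idx M N) (hi : i.1 ≠ M) (x : Gen M N true)
    (hx : ∀ j n, x ≠ Gen.Xp j n) : gA q M N x ∈ NF (gA q M N (Gen.Xm i 0)) := by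
  have hz : ∀ n : ℤ, q ^ n ≠ 0 := fun n => zpow_ne_zero n hq0
  rcases x with ⟨j, n⟩ | ⟨j, n⟩ | j | j | ⟨j, s⟩ | h | h
  · exact absurd rfl (hx j n)
  · exact NF_Xm hq0 i j hi n
  · exact NF_of0 _ _ _
      (flip_c _ _ _ (hz _) (a_KXm j i 0))
  · exact NF_of0 _ _ _
      (flip_c _ _ _ (inv_ne_zero (hz _)) (inv_comm _ _ _ (a_KKi j) (a_KiK j) _ (hz _) (a_KXm j i 0)))
  · have h := a_HXm (q := q) j i s 0
    refine NF_of _ _ (((qint (qpar q M j.1) (s.1 * lof M j.1 * cc M j.1 i.1) / (s.1 : ℂ)) •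
          gA q M N (Gen.Xm i (0 + s.1)))) 1 ?_ (Subalgebra.smul_mem _ (NF_Xm hq0 i i hi _) _)
    rw [sub_eq_iff_eq_add] at h
    rw [h, one_smul]; abel
  · exact NF_of0 _ _ _
      (flip_c _ _ _ (hz _) (a_K0Xm i 0))
  · exact NF_of0 _ _ _
      (flip_c _ _ _ (inv_ne_zero (hz _)) (inv_comm _ _ _ a_K0K0i a_K0iK0 _ (hz _) (a_K0Xm i 0)))

end QASX

namespace QASX
open QAS

variable {q : ℂ} {M N : ℕ}

theorem a_KK (i j : Idx M N) : gA q M N (Gen.K i) * gA q M N (Gen.K j) =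
    gA q M N (Gen.K j) * gA q M N (Gen.K i) := by
  have := relA (rel.KK (q := q) (lvl := 3) (ext := true) i j)
  simpa only [gA, map_mul] using this

theorem a_KKi2 (i j : Idx M N) : gA q M N (Gen.K i) * gA q M N (Gen.Ki j) =
    gA q M N (Gen.Ki j) * gA q M N (Gen.K i) := by
  have := relA (rel.KKi2 (q := q) (lvl := 3) (ext := true) i j)
  simpa only [gA, map_mul] using this

theorem a_KH (i j : Idx M N) (s : {s : ℤ // s ≠ 0}) :
    gA q M N (Gen.K i) * gA q M N (Gen.H j s) = gA q M N (Gen.H j s) * gA q M N (Gen.K i) := by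
  have := relA (rel.KH (q := q) (lvl := 3) (ext := true) i j s)
  simpa only [gA, map_mul] using this

theorem a_K0K (i : Idx M N) : gA q M N (Gen.K0 rfl) * gA q M N (Gen.K i) =
    gA q M N (Gen.K i) * gA q M N (Gen.K0 rfl) := by
  have := relA (rel.K0K (q := q) (lvl := 3) rfl i)
  simpa only [gA, map_mul] using this

theorem a_K0Ki (i : Idx M N) : gA q M N (Gen.K0 rfl) * gA q M N (Gen.Ki i) =
    gA q M N (Gen.Ki i) * gA q M N (Gen.K0 rfl) := by
  have := relA (rel.K0Ki (q := q) (lvl := 3) rfl i)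
  simpa only [gA, map_mul] using this

theorem a_K0H (i : Idx M N) (s : {s : ℤ // s ≠ 0}) :
    gA q M N (Gen.K0 rfl) * gA q M N (Gen.H i s) =
      gA q M N (Gen.H i s) * gA q M N (Gen.K0 rfl) := by
  have := relA (rel.K0H (q := q) (lvl := 3) rfl i s)
  simpa only [gA, map_mul] using this

/-- generators of Cartan type -/
def isZ : Gen M N true → Prop
  | Gen.Xp _ _ => False
  | Gen.Xm _ _ => False
  | _ => True

theorem comm_K (i : Idx M N) (z : Gen M N true) (hz : isZ z) :
    gA q M N (Gen.K i) * gA q M N z = gA q M N z * gA q M N (Gen.K i) := by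
  rcases z with ⟨j, n⟩ | ⟨j, n⟩ | j | j | ⟨j, s⟩ | h | h
  · exact hz.elim
  · exact hz.elim
  · exact a_KK i j
  · exact a_KKi2 i j
  · exact a_KH i j s
  · exact (a_K0K i).symm
  · have := inv_comm _ _ (gA q M N (Gen.K i)) a_K0K0i a_K0iK0 1 one_ne_zero
      (by rw [one_smul]; exact a_K0K i)
    rw [inv_one, one_smul] at this
    exact this.symm

theorem comm_K0 (z : Gen M N true) (hz : isZ z) :
    gA q M N (Gen.K0 rfl) * gA q M N z = gA q M N z * gA q M N (Gen.K0 rfl) := by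
  rcases z with ⟨j, n⟩ | ⟨j, n⟩ | j | j | ⟨j, s⟩ | h | h
  · exact hz.elim
  · exact hz.elim
  · exact a_K0K j
  · exact a_K0Ki j
  · exact a_K0H j s
  · rfl
  · exact a_K0K0i.trans a_K0iK0.symm

/-- words in lowering and Cartan generators, with their degree -/
inductive Wd (q : ℂ) (M N : ℕ) : (ℕ → ℤ) → ALG q M N true 3 → Prop
  | one : Wd q M N 0 1
  | z (u y x) (hx : isZ x) (h : Wd q M N u y) : Wd q M N u (gA q M N x * y)
  | xm (u y) (j : Idx M N) (n : ℤ) (h : Wd q M N u y) :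
      Wd q M N (u + Pi.single j.1 1) (gA q M N (Gen.Xm j n) * y)

theorem Wd_nonneg {u y} (h : Wd q M N u y) (j : ℕ) : 0 ≤ u j := by
  induction h with
  | one => simp
  | z u y x hx h ih => exact ih
  | xm u y i n h ih =>
    rw [Pi.add_apply]
    refine add_nonneg ih ?_
    rw [Pi.single_apply]; split_ifs <;> simp

theorem Wd_supp {u y} (h : Wd q M N u y) (j : ℕ) (hj : ¬ (1 ≤ j ∧ j ≤ M + N - 1)) : u j = 0 := by
  induction h with
  | one => simp
  | z u y x hx h ih => exact ih
  | xm u y i n h ih =>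
    rw [Pi.add_apply, ih, Pi.single_apply, if_neg, add_zero]
    rintro rfl
    exact hj i.2

theorem Wd_NF (hq0 : q ≠ 0) (i : Idx M N) (hi : i.1 ≠ M) {u y} (h : Wd q M N u y) :
    y ∈ NF (gA q M N (Gen.Xm i 0)) := by
  induction h with
  | one => exact Subalgebra.one_mem _
  | z u y x hx h ih =>
    refine mul_mem (NF_zero hq0 i hi x ?_) ih
    rintro j n rfl
    exact hx
  | xm u y j n h ih =>
    exact mul_mem (NF_Xm hq0 i j hi n) ih

theorem prod_step (θ : ℕ → ℂ) (hθ : ∀ j, θ j ≠ 0) (u : ℕ → ℤ) (a : ℕ) (s : Finset ℕ) (ha : a ∈ s) :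
    ∏ j ∈ s, θ j ^ (-((u + Pi.single a 1 : ℕ → ℤ) j)) = (θ a)⁻¹ * ∏ j ∈ s, θ j ^ (-(u j)) := by
  have h : ∀ j, θ j ^ (-((u + Pi.single a 1 : ℕ → ℤ) j)) =
      (if j = a then (θ a)⁻¹ else 1) * θ j ^ (-(u j)) := by
    intro j
    rw [Pi.add_apply, Pi.single_apply, neg_add_rev, zpow_add₀ (hθ j)]
    split_ifs with hj
    · subst hj; rw [zpow_neg_one]
    · simp
  rw [Finset.prod_congr rfl (fun j _ => h j), Finset.prod_mul_distrib, Finset.prod_ite_eq' ,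
    if_pos ha]

theorem Wd_wt (T : ALG q M N true 3) (θ : ℕ → ℂ) (hθ : ∀ j, θ j ≠ 0)
    (hz : ∀ z, isZ z → T * gA q M N z = gA q M N z * T)
    (hX : ∀ (j : Idx M N) n, T * gA q M N (Gen.Xm j n) =
      (θ j.1)⁻¹ • (gA q M N (Gen.Xm j n) * T))
    {u y} (h : Wd q M N u y) :
    T * y = (∏ j ∈ Finset.Icc 1 (M + N - 1), θ j ^ (-(u j))) • (y * T) := by
  induction h with
  | one => simp
  | z u y x hx h ih =>
    rw [← mul_assoc, hz x hx, mul_assoc, ih, mul_smul_comm, mul_assoc]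
  | xm u y a n h ih =>
    rw [← mul_assoc, hX, prod_step θ hθ u a.1 _ (Finset.mem_Icc.2 a.2), smul_mul_assoc, mul_assoc,
      ih, mul_smul_comm, smul_smul, mul_assoc]

variable (Λ : HW q M N)

theorem ssc (a : ALG q M N true 3) (c : ℂ) (w : UWeylMod q M N true Λ) :
    (c • a) • w = c • (a • w) := smul_smul_c a c w

theorem eq_neg_zero {A : Type*} [Ring A] [Algebra ℂ A] (x : A) (h : x = (-1 : ℂ) • x) : x = 0 := by
  rw [neg_one_smul, eq_neg_iff_add_eq_zero, ← two_smul ℂ, smul_eq_zero] at h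
  exact h.resolve_left two_ne_zero

/-- the highest weight vector -/
def hv : UWeylMod q M N true Λ :=
  (Submodule.Quotient.mk 1 : ALG q M N true 3 ⧸ uweylIdeal q M N true Λ)

theorem smul_hv (x : ALG q M N true 3) : x • hv Λ =
    (Submodule.Quotient.mk x : ALG q M N true 3 ⧸ uweylIdeal q M N true Λ) := by
  have : x • hv Λ = (Submodule.Quotient.mk (x • (1 : ALG q M N true 3)) :
    ALG q M N true 3 ⧸ uweylIdeal q M N true Λ) := rfl
  rw [this, smul_eq_mul, mul_one]

theorem hv_rel (x : ALG q M N true 3) (hx : x ∈ vermaRels q M N true Λ ∪ evenRels q M N true Λ) :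
    x • hv Λ = 0 := by
  rw [smul_hv]
  exact (Submodule.Quotient.mk_eq_zero _).2 (Ideal.subset_span hx)

theorem hv_gen (w : UWeylMod q M N true Λ) : ∃ y : ALG q M N true 3, w = y • hv Λ := by
  obtain ⟨y, hy⟩ := Submodule.Quotient.mk_surjective (uweylIdeal q M N true Λ) w
  exact ⟨y, by rw [smul_hv, hy]⟩

theorem hv_Xp (i : Idx M N) (n : ℤ) : gA q M N (Gen.Xp i n) • hv Λ = 0 := by
  rw [← XpA_eq]
  exact hv_rel Λ _ (Or.inl (Or.inl (Or.inl (Or.inl (Or.inl ⟨i.1, n, rfl⟩)))))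

theorem hv_even (i : Idx M N) (hi : i.1 ≠ M) :
    gA q M N (Gen.Xm i 0) ^ (1 + (Λ.P i.1).natDegree) • hv Λ = 0 := by
  rw [← XmA_eq]
  exact hv_rel Λ _ (Or.inr ⟨i.1, i.2.1, i.2.2, hi, rfl⟩)

theorem hv_K0 : gA q M N (Gen.K0 rfl) • hv Λ = hv Λ := by
  have := hv_rel Λ (K0A q M N true 3 - 1) (Or.inl (Or.inr ⟨rfl, rfl⟩))
  rw [sub_smul, one_smul, sub_eq_zero, K0A_eq] at this
  exact this

theorem hv_KM (i : Idx M N) (hi : i.1 = M) : gA q M N (Gen.K i) • hv Λ = Λ.c • hv Λ := by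
  have := hv_rel Λ (KA q M N true 3 M - algebraMap ℂ _ Λ.c) (Or.inl (Or.inl (Or.inl (Or.inr rfl))))
  rw [sub_smul, sub_eq_zero, algebraMap_smul] at this
  have e : KA q M N true 3 M = gA q M N (Gen.K i) := by
    rw [← KA_eq i, hi]
  rw [← e]
  exact this

theorem phiP_zero (i : Idx M N) : mkA q M N true 3 (phiPF q M N true i.1 0) =
    gA q M N (Gen.K i) := by
  unfold phiPF KF
  rw [if_pos le_rfl, dif_pos i.2, Int.toNat_zero, expC, mul_one]; rfl

theorem phiM_zero (i : Idx M N) : mkA q M N true 3 (phiMF q M N true i.1 0) =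
    gA q M N (Gen.Ki i) := by
  unfold phiMF KiF
  rw [if_pos le_rfl, dif_pos i.2, neg_zero, Int.toNat_zero, expC, mul_one]; rfl

theorem gammaP_zero (i : ℕ) (P : Polynomial ℂ) (hP : P.coeff 0 = 1) :
    gammaP q M i P 0 = qpar q M i ^ P.natDegree := by
  have h : ∀ a : ℂ, (pscale a P).coeff 0 = 1 := by
    intro a
    unfold pscale
    rw [Polynomial.coeff_zero_eq_eval_zero, Polynomial.eval_comp]
    simp [← Polynomial.coeff_zero_eq_eval_zero, hP]
  unfold gammaP
  rw [if_pos le_rfl, Int.toNat_zero, PowerSeries.coeff_zero_eq_constantCoeff_apply, map_mul,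
    PowerSeries.constantCoeff_inv]
  unfold toPS
  rw [← PowerSeries.coeff_zero_eq_constantCoeff_apply,
    ← PowerSeries.coeff_zero_eq_constantCoeff_apply, PowerSeries.coeff_mk, PowerSeries.coeff_mk,
    h, h]
  simp

theorem hv_K (i : Idx M N) (hi : i.1 ≠ M) :
    gA q M N (Gen.K i) • hv Λ = (qpar q M i.1 ^ (Λ.P i.1).natDegree) • hv Λ := by
  have := hv_rel Λ (phiPA q M N true 3 i.1 0 - algebraMap ℂ _ (gammaP q M i.1 (Λ.P i.1) 0))
    (Or.inl (Or.inl (Or.inl (Or.inl (Or.inr ⟨i.1, 0, i.2.1, i.2.2, hi, Or.inl rfl⟩)))))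
  rw [sub_smul, sub_eq_zero, algebraMap_smul, gammaP_zero _ _ (Λ.P_const _)] at this
  rw [← phiP_zero]
  exact this

/-- span of the words of degree `u` -/
def Wsub (u : ℕ → ℤ) : Submodule ℂ (UWeylMod q M N true Λ) :=
  Submodule.span ℂ {w | ∃ y, Wd q M N u y ∧ w = y • hv Λ}

theorem Wsub_ind {u : ℕ → ℤ} (T : Submodule ℂ (UWeylMod q M N true Λ))
    (h : ∀ y, Wd q M N u y → y • hv Λ ∈ T) : Wsub Λ u ≤ T := by
  refine Submodule.span_le.2 ?_
  rintro _ ⟨y, hy, rfl⟩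
  exact h y hy

theorem Wsub_word {u y} (h : Wd q M N u y) : y • hv Λ ∈ Wsub Λ u :=
  Submodule.subset_span ⟨y, h, rfl⟩

/-- an element acting as a `ℂ`-linear map -/
def act (a : ALG q M N true 3) : Module.End ℂ (UWeylMod q M N true Λ) where
  toFun w := a • w
  map_add' := smul_add a
  map_smul' c w := sc a c w

theorem act_apply (a : ALG q M N true 3) (w) : act Λ a w = a • w := rfl

theorem act_pow (a : ALG q M N true 3) (n : ℕ) (w) : (act Λ a ^ n) w = a ^ n • w := by
  induction n generalizing w with
  | zero => simp
  | succ n ih => rw [pow_succ, pow_succ, Module.End.mul_apply, ih, act_apply, mul_smul]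

theorem Wsub_map {u t : ℕ → ℤ} (a : ALG q M N true 3)
    (h : ∀ y, Wd q M N u y → a • y • hv Λ ∈ Wsub Λ t) {w} (hw : w ∈ Wsub Λ u) :
    a • w ∈ Wsub Λ t :=
  Wsub_ind Λ ((Wsub Λ t).comap (act Λ a)) h hw

theorem Wsub_z {u : ℕ → ℤ} (x : Gen M N true) (hx : isZ x) {w} (hw : w ∈ Wsub Λ u) :
    gA q M N x • w ∈ Wsub Λ u := by
  refine Wsub_map Λ _ (fun y hy => ?_) hw
  rw [← mul_smul]
  exact Wsub_word Λ (Wd.z _ _ _ hx hy)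

theorem Wsub_xm {u : ℕ → ℤ} (j : Idx M N) (n : ℤ) {w} (hw : w ∈ Wsub Λ u) :
    gA q M N (Gen.Xm j n) • w ∈ Wsub Λ (u + Pi.single j.1 1) := by
  refine Wsub_map Λ _ (fun y hy => ?_) hw
  rw [← mul_smul]
  exact Wsub_word Λ (Wd.xm _ _ _ _ hy)

theorem Wsub_phiP {u : ℕ → ℤ} (i : Idx M N) (n : ℤ) {w} (hw : w ∈ Wsub Λ u) :
    mkA q M N true 3 (phiPF q M N true i.1 n) • w ∈ Wsub Λ u :=
  phiP_mem (stab (Wsub Λ u)) (fun i w hw => Wsub_z Λ (Gen.K i) trivial hw)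
    (fun i s w hw => Wsub_z Λ (Gen.H i s) trivial hw) i n w hw

theorem Wsub_phiM {u : ℕ → ℤ} (i : Idx M N) (n : ℤ) {w} (hw : w ∈ Wsub Λ u) :
    mkA q M N true 3 (phiMF q M N true i.1 n) • w ∈ Wsub Λ u :=
  phiM_mem (stab (Wsub Λ u)) (fun i w hw => Wsub_z Λ (Gen.Ki i) trivial hw)
    (fun i s w hw => Wsub_z Λ (Gen.H i s) trivial hw) i n w hw

theorem Wd_xp (hq0 : q ≠ 0) {u y} (h : Wd q M N u y) : ∀ (i : Idx M N) (n : ℤ),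
    gA q M N (Gen.Xp i n) • y • hv Λ ∈ Wsub Λ (u - Pi.single i.1 1) := by
  have hqz : ∀ n : ℤ, q ^ n ≠ 0 := fun n => zpow_ne_zero n hq0
  induction h with
  | one =>
    intro i n
    rw [one_smul, hv_Xp]; exact zero_mem _
  | z u y x hx h ih =>
    intro i n
    have key : ∀ c : ℂ, gA q M N (Gen.Xp i n) * gA q M N x =
        c • (gA q M N x * gA q M N (Gen.Xp i n)) →
        gA q M N (Gen.Xp i n) • (gA q M N x * y) • hv Λ ∈ Wsub Λ (u - Pi.single i.1 1) := by
      intro c hc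
      rw [mul_smul, ← mul_smul, hc, ssc Λ, mul_smul]
      exact Submodule.smul_mem _ _ (Wsub_z Λ x hx (ih i n))
    rcases x with ⟨j, m⟩ | ⟨j, m⟩ | j | j | ⟨j, s⟩ | h | h
    · exact hx.elim
    · exact hx.elim
    · exact key _ (flip_c _ _ _ (hqz _) (a_KXp j i n))
    · exact key _ (flip_c _ _ _ (inv_ne_zero (hqz _))
        (inv_comm _ _ _ (a_KKi j) (a_KiK j) _ (hqz _) (a_KXp j i n)))
    · have h1 := a_HXp (q := q) j i s n
      rw [sub_eq_iff_eq_add, add_comm, ← sub_eq_iff_eq_add] at h1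
      rw [mul_smul, ← mul_smul, ← h1, sub_smul, mul_smul, ssc Λ]
      exact sub_mem (Wsub_z Λ _ hx (ih i n)) (Submodule.smul_mem _ _ (ih i _))
    · exact key _ (flip_c _ _ _ (hqz _) (a_K0Xp i n))
    · exact key _ (flip_c _ _ _ (inv_ne_zero (hqz _))
        (inv_comm _ _ _ a_K0K0i a_K0iK0 _ (hqz _) (a_K0Xp i n)))
  | xm u y j m h ih =>
    intro i n
    have h1 := a_XpXm (q := q) i j n m
    rw [sub_eq_iff_eq_add] at h1
    rw [mul_smul, ← mul_smul, h1, add_smul, ssc Λ, mul_smul]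
    refine add_mem ?_ (Submodule.smul_mem _ _ ?_)
    · split_ifs with hij
      · subst hij
        have e : u + Pi.single i.1 1 - Pi.single i.1 1 = u := add_sub_cancel_right _ _
        rw [e, ssc Λ, sub_smul]
        exact Submodule.smul_mem _ _ (sub_mem (Wsub_phiP Λ i _ (Wsub_word Λ h))
          (Wsub_phiM Λ i _ (Wsub_word Λ h)))
      · rw [zero_smul]; exact zero_mem _
    · have e : u + Pi.single j.1 1 - Pi.single i.1 1 = u - Pi.single i.1 1 + Pi.single j.1 1 := by
        abel
      rw [e]
      exact Wsub_xm Λ j m (ih i n)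

theorem Wsub_xp (hq0 : q ≠ 0) {u : ℕ → ℤ} (i : Idx M N) (n : ℤ) {w} (hw : w ∈ Wsub Λ u) :
    gA q M N (Gen.Xp i n) • w ∈ Wsub Λ (u - Pi.single i.1 1) :=
  Wsub_map Λ _ (fun _ hy => Wd_xp Λ hq0 hy i n) hw

theorem Wsub_xp_pow (hq0 : q ≠ 0) {u : ℕ → ℤ} (i : Idx M N) (m : ℕ) {w} (hw : w ∈ Wsub Λ u) :
    gA q M N (Gen.Xp i 0) ^ m • w ∈ Wsub Λ (u - Pi.single i.1 (m : ℤ)) := by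
  induction m with
  | zero => simpa using hw
  | succ m ih =>
    rw [pow_succ', mul_smul]
    have := Wsub_xp Λ hq0 i 0 ih
    convert this using 2
    rw [sub_sub, ← Pi.single_add]; push_cast; rfl

theorem Wsub_ne {u : ℕ → ℤ} (h : Wsub Λ u ≠ ⊥) : ∃ y, Wd q M N u y := by
  by_contra hc
  push Not at hc
  refine h (le_bot_iff.1 (Wsub_ind Λ _ fun y hy => absurd hy (hc y)))

theorem Wsub_top (hq0 : q ≠ 0) : ⨆ u, Wsub Λ u = ⊤ := by
  rw [eq_top_iff]
  rintro w -
  obtain ⟨y, rfl⟩ := hv_gen Λ w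
  have key : ∀ a : ALG q M N true 3, (∀ u, ∃ t, ∀ w ∈ Wsub Λ u, a • w ∈ Wsub Λ t) →
      a ∈ stab (⨆ u, Wsub Λ u) := by
    intro a ha w hw
    have : (⨆ u, Wsub Λ u) ≤ (⨆ u, Wsub Λ u).comap (act Λ a) := by
      refine iSup_le fun u w hw => ?_
      obtain ⟨t, ht⟩ := ha u
      exact Submodule.mem_iSup_of_mem t (ht w hw)
    exact this hw
  refine gen_top (stab (⨆ u, Wsub Λ u)) (fun x => key _ fun u => ?_) y _
    (Submodule.mem_iSup_of_mem 0 ?_)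
  · by_cases hx : isZ x
    · exact ⟨u, fun w hw => Wsub_z Λ x hx hw⟩
    · rcases x with ⟨j, m⟩ | ⟨j, m⟩ | j | j | ⟨j, s⟩ | h | h
      · exact ⟨_, fun w hw => Wsub_xp Λ hq0 j m hw⟩
      · exact ⟨_, fun w hw => Wsub_xm Λ j m hw⟩
      all_goals exact absurd trivial hx
  · have := Wsub_word Λ (Wd.one (q := q) (M := M) (N := N))
    rwa [one_smul] at this

theorem top_ind (hq0 : q ≠ 0) (T : Submodule ℂ (UWeylMod q M N true Λ))
    (h : ∀ u, Wsub Λ u ≤ T) (w) : w ∈ T := by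
  have : (⊤ : Submodule ℂ (UWeylMod q M N true Λ)) ≤ T := by
    rw [← Wsub_top Λ hq0]; exact iSup_le h
  exact this trivial

theorem nil_xp (hq0 : q ≠ 0) (i : Idx M N) (w : UWeylMod q M N true Λ) :
    ∃ m : ℕ, gA q M N (Gen.Xp i 0) ^ m • w = 0 := by
  refine top_ind Λ hq0 (nilS _ (gA q M N (Gen.Xp i 0))) (fun u w hw => ?_) w
  refine ⟨(u i.1).toNat + 1, ?_⟩
  have h := Wsub_xp_pow Λ hq0 i ((u i.1).toNat + 1) hw
  by_cases hb : Wsub Λ (u - Pi.single i.1 (((u i.1).toNat + 1 : ℕ) : ℤ)) = ⊥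
  · rw [hb] at h; exact h
  · obtain ⟨y, hy⟩ := Wsub_ne Λ hb
    have := Wd_nonneg hy i.1
    rw [Pi.sub_apply, Pi.single_eq_same] at this
    omega

theorem cc_MM : cc M M M = 0 := by
  unfold cc form4 innerE lof
  split_ifs <;> omega

theorem nil_xm (hq0 : q ≠ 0) (i : Idx M N) (w : UWeylMod q M N true Λ) :
    ∃ m : ℕ, gA q M N (Gen.Xm i 0) ^ m • w = 0 := by
  by_cases hi : i.1 = M
  · refine ⟨2, ?_⟩
    have h := a_XX0m (q := q) i i 0 0 (by rw [hi]; exact cc_MM)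
    unfold sgn at h
    rw [if_pos ⟨hi, hi⟩] at h
    rw [sq, eq_neg_zero (gA q M N (Gen.Xm i 0) * gA q M N (Gen.Xm i 0)) h, zero_smul]
  · refine top_ind Λ hq0 (nilS _ (gA q M N (Gen.Xm i 0))) (fun u => Wsub_ind Λ _ fun y hy => ?_) w
    exact NF_nil _ y (Wd_NF hq0 i hi hy) (hv Λ) _ (hv_even Λ i hi)

theorem cc_symm (i j : ℕ) : cc M i j = cc M j i := by
  unfold cc form4 innerE
  split_ifs <;> subst_vars <;> omega

/-- weights of the graded pieces -/
theorem Wsub_K (hq0 : q ≠ 0) {u : ℕ → ℤ} (i : ℕ) (hi : i < M + N) {w} (hw : w ∈ Wsub Λ u) :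
    Kgen q M N true 3 i • w = (lamF q M N Λ i *
      ∏ j ∈ Finset.Icc 1 (M + N - 1), alF q M j i ^ (-(u j))) • w := by
  have hqz : ∀ n : ℤ, q ^ n ≠ 0 := fun n => zpow_ne_zero n hq0
  have hal : ∀ j, alF q M j i ≠ 0 := by
    intro j; unfold alF; split_ifs
    · exact hq0
    · exact one_ne_zero
    · exact hqz _
  have key : (∀ z, isZ z → Kgen q M N true 3 i * gA q M N z = gA q M N z * Kgen q M N true 3 i) ∧
    (∀ (j : Idx M N) n, Kgen q M N true 3 i * gA q M N (Gen.Xm j n) =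
      (alF q M j.1 i)⁻¹ • (gA q M N (Gen.Xm j n) * Kgen q M N true 3 i)) ∧
    Kgen q M N true 3 i • hv Λ = lamF q M N Λ i • hv Λ := by
    unfold Kgen alF lamF
    by_cases h0 : i = 0
    · simp only [if_pos h0, K0A_eq, one_smul]
      refine ⟨comm_K0, fun j n => ?_, hv_K0 Λ⟩
      rw [a_K0Xm]; split_ifs <;> simp
    · simp only [if_neg h0]
      obtain ⟨a, rfl⟩ : ∃ a : Idx M N, a.1 = i := ⟨⟨i, by omega, by omega⟩, rfl⟩
      rw [KA_eq]
      refine ⟨comm_K a, fun j n => ?_, ?_⟩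
      · rw [a_KXm, zpow_neg, cc_symm]
      · split_ifs with h
        · exact hv_KM Λ a h
        · exact hv_K Λ a h
  obtain ⟨h1, h2, h3⟩ := key
  refine (Wsub_ind Λ (LinearMap.eqLocus (act Λ (Kgen q M N true 3 i)) ((lamF q M N Λ i *
      ∏ j ∈ Finset.Icc 1 (M + N - 1), alF q M j i ^ (-(u j))) • LinearMap.id)) ?_) hw
  intro y hy
  change Kgen q M N true 3 i • y • hv Λ = (lamF q M N Λ i *
      ∏ j ∈ Finset.Icc 1 (M + N - 1), alF q M j i ^ (-(u j))) • (y • hv Λ)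
  rw [← mul_smul, Wd_wt _ _ hal h1 h2 hy, ssc Λ, mul_smul, h3, sc, smul_smul, mul_comm]

end QASX

namespace QASX
open QAS

variable {q : ℂ} {M N : ℕ} (Λ : HW q M N)

theorem prod_zpow_sum (hq0 : q ≠ 0) (s : Finset ℕ) (g : ℕ → ℤ) :
    ∏ j ∈ s, q ^ g j = q ^ (∑ j ∈ s, g j) := by
  induction s using Finset.induction_on with
  | empty => simp
  | insert a s ha ih => rw [Finset.prod_insert ha, Finset.sum_insert ha, zpow_add₀ hq0, ih]

theorem cc_formula (i j : ℕ) (hi1 : 1 ≤ i) (hi : i ≠ M) : cc M j i =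
    lof M i * (2 * (if j = i then 1 else 0) - (if j = i - 1 then 1 else 0) -
      (if j = i + 1 then 1 else 0)) := by
  unfold cc form4 innerE lof
  split_ifs <;> omega

theorem cc_diag (i : ℕ) (hi : i ≠ M) : cc M i i = lof M i * 2 := by
  unfold cc form4 innerE lof
  split_ifs <;> omega

theorem sum_formula (i : Idx M N) (hi : i.1 ≠ M) (u : ℕ → ℤ)
    (hu : ∀ j, ¬ (1 ≤ j ∧ j ≤ M + N - 1) → u j = 0) :
    ∑ j ∈ Finset.Icc 1 (M + N - 1), cc M j i.1 * (-(u j)) =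
      lof M i.1 * (u (i.1 - 1) + u (i.1 + 1) - 2 * u i.1) := by
  have h1 : ∀ a : ℕ, ∑ j ∈ Finset.Icc 1 (M + N - 1), (if j = a then u j else 0) = u a := by
    intro a
    rw [Finset.sum_ite_eq']
    split_ifs with h
    · rfl
    · rw [Finset.mem_Icc] at h; exact (hu a h).symm
  have h2 : ∀ j, cc M j i.1 * (-(u j)) = lof M i.1 * ((if j = i.1 - 1 then u j else 0) +
      (if j = i.1 + 1 then u j else 0) - 2 * (if j = i.1 then u j else 0)) := by
    intro j
    rw [cc_formula i.1 j i.2.1 hi]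
    split_ifs <;> ring
  rw [Finset.sum_congr rfl (fun j _ => h2 j), ← Finset.mul_sum, Finset.sum_sub_distrib,
    Finset.sum_add_distrib, ← Finset.mul_sum, h1, h1, h1]

theorem Wsub_Ki (hq0 : q ≠ 0) {u : ℕ → ℤ} (hne : Wsub Λ u ≠ ⊥) (i : Idx M N) (hi : i.1 ≠ M) {w}
    (hw : w ∈ Wsub Λ u) : gA q M N (Gen.K i) • w =
      (qpar q M i.1 ^ (((Λ.P i.1).natDegree : ℤ) + u (i.1 - 1) + u (i.1 + 1) - 2 * u i.1)) • w := by
  have hi0 : i.1 ≠ 0 := by have := i.2.1; omega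
  have h := Wsub_K Λ hq0 i.1 (by have := i.2; omega) hw
  unfold Kgen lamF alF at h
  simp only [if_neg hi0, if_neg hi, KA_eq] at h
  obtain ⟨y, hy⟩ := Wsub_ne Λ hne
  rw [h]
  congr 1
  simp only [← zpow_mul]
  rw [prod_zpow_sum hq0, sum_formula i hi u (fun j hj => Wd_supp hy j hj)]
  unfold qpar
  rw [← zpow_natCast, ← zpow_mul, ← zpow_mul, ← zpow_add₀ hq0]
  congr 1
  ring

theorem lof_cases (i : ℕ) : lof M i = 1 ∨ lof M i = -1 := by
  unfold lof; split_ifs <;> simp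

theorem refl_step (hq0 : q ≠ 0) (hq1 : ∀ k : ℕ, k ≠ 0 → q ^ k ≠ 1) {u : ℕ → ℤ}
    (hne : Wsub Λ u ≠ ⊥) (i : Idx M N) (hi : i.1 ≠ M)
    (he : ((Λ.P i.1).natDegree : ℤ) + u (i.1 - 1) + u (i.1 + 1) - 2 * u i.1 < 0) :
    Wsub Λ (Function.update u i.1
      (((Λ.P i.1).natDegree : ℤ) + u (i.1 - 1) + u (i.1 + 1) - u i.1)) ≠ ⊥ := by
  intro hbot
  obtain ⟨w, hw, hw0⟩ := Submodule.exists_mem_ne_zero_of_ne_bot hne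
  apply hw0
  set e := ((Λ.P i.1).natDegree : ℤ) + u (i.1 - 1) + u (i.1 + 1) - 2 * u i.1 with hedef
  have hp0 : qpar q M i.1 ≠ 0 := zpow_ne_zero _ hq0
  have hp1 : ∀ k : ℕ, k ≠ 0 → qpar q M i.1 ^ k ≠ 1 := by
    intro k hk h
    unfold qpar at h
    rcases lof_cases (M := M) i.1 with hl | hl
    · rw [hl, zpow_one] at h; exact hq1 k hk h
    · rw [hl, zpow_neg_one, inv_pow, inv_eq_one] at h; exact hq1 k hk h
  obtain ⟨m, hm⟩ : ∃ m : ℕ, (m : ℤ) = -e := ⟨(-e).toNat, by omega⟩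
  obtain ⟨t, ht⟩ := nil_xm Λ hq0 i w
  refine sl2_inj (qpar q M i.1) hp0 hp1 (act Λ (gA q M N (Gen.Xp i 0)))
    (act Λ (gA q M N (Gen.Xm i 0))) (act Λ (gA q M N (Gen.K i))) (act Λ (gA q M N (Gen.Ki i)))
    ?_ ?_ ?_ ?_ ?_ w m ?_ ?_ t ?_
  · ext x
    change gA q M N (Gen.K i) • gA q M N (Gen.Ki i) • x = x
    rw [← mul_smul, a_KKi, one_smul]
  · ext x
    change gA q M N (Gen.Ki i) • gA q M N (Gen.K i) • x = x
    rw [← mul_smul, a_KiK, one_smul]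
  · ext x
    change gA q M N (Gen.K i) • gA q M N (Gen.Xp i 0) • x =
      (qpar q M i.1 ^ (2 : ℤ)) • gA q M N (Gen.Xp i 0) • gA q M N (Gen.K i) • x
    rw [← mul_smul, a_KXp, ssc Λ, mul_smul, cc_diag _ hi, zpow_mul]; rfl
  · ext x
    change gA q M N (Gen.K i) • gA q M N (Gen.Xm i 0) • x =
      (qpar q M i.1 ^ (-2 : ℤ)) • gA q M N (Gen.Xm i 0) • gA q M N (Gen.K i) • x
    rw [← mul_smul, a_KXm, ssc Λ, mul_smul, cc_diag _ hi, ← mul_neg, zpow_mul]; rfl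
  · ext x
    change gA q M N (Gen.Xp i 0) • gA q M N (Gen.Xm i 0) • x -
      gA q M N (Gen.Xm i 0) • gA q M N (Gen.Xp i 0) • x =
        (qpar q M i.1 - (qpar q M i.1)⁻¹)⁻¹ •
          (gA q M N (Gen.K i) • x - gA q M N (Gen.Ki i) • x)
    have h := a_XpXm (q := q) i i 0 0
    have hs : sgn M i.1 i.1 = 1 := by unfold sgn; rw [if_neg (fun h => hi h.1)]
    rw [if_pos rfl, add_zero, phiP_zero, phiM_zero, hs] at h
    have h' := congrArg (fun a => a • x) h
    simp only [sub_smul, ssc Λ, one_smul, mul_smul] at h'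
    exact h'
  · rw [act_apply, Wsub_Ki Λ hq0 hne i hi hw, hm, neg_neg]
  · rw [act_pow]
    have h := Wsub_xp_pow Λ hq0 i m hw
    have e2 : u - Pi.single i.1 (m : ℤ) = Function.update u i.1
      (((Λ.P i.1).natDegree : ℤ) + u (i.1 - 1) + u (i.1 + 1) - u i.1) := by
      funext j
      by_cases hj : j = i.1
      · subst hj
        rw [Pi.sub_apply, Pi.single_eq_same, Function.update_self]; omega
      · rw [Pi.sub_apply, Pi.single_eq_of_ne hj, Function.update_of_ne hj, sub_zero]
    rw [e2, hbot] at h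
    exact h
  · rw [act_pow]; exact ht

theorem bounds (hq0 : q ≠ 0) (hq1 : ∀ k : ℕ, k ≠ 0 → q ^ k ≠ 1) (hM : 1 ≤ M) (hN : 1 ≤ N) :
    ∃ k : ℕ, 0 < k ∧ ∀ u, Wsub Λ u ≠ ⊥ → ∀ i, 1 ≤ i → i ≤ M + N - 1 → -(k : ℤ) < u M - u i := by
  obtain ⟨B1, hB1⟩ := comb M (fun j => ((Λ.P j).natDegree : ℤ))
  obtain ⟨B2, hB2⟩ := comb N (fun j => ((Λ.P (M + N - j)).natDegree : ℤ))
  have hn : ∀ u, Wsub Λ u ≠ ⊥ → ∀ j, 0 ≤ u j := by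
    intro u hu j
    obtain ⟨y, hy⟩ := Wsub_ne Λ hu
    exact Wd_nonneg hy j
  have hs : ∀ u, Wsub Λ u ≠ ⊥ → ∀ j, ¬ (1 ≤ j ∧ j ≤ M + N - 1) → u j = 0 := by
    intro u hu j hj
    obtain ⟨y, hy⟩ := Wsub_ne Λ hu
    exact Wd_supp hy j hj
  have h1 := hB1 {u | Wsub Λ u ≠ ⊥} (fun u hu => hs u hu 0 (by omega)) hn (by
    intro u hu j hj1 hjM he
    exact refl_step Λ hq0 hq1 hu ⟨j, hj1, by omega⟩ (by change j ≠ M; omega) he)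
  have h2 := hB2 {t | ∃ u, Wsub Λ u ≠ ⊥ ∧ t = fun j => u (M + N - j)} (by
    rintro _ ⟨u, hu, rfl⟩
    exact hs u hu _ (by omega)) (by
    rintro _ ⟨u, hu, rfl⟩ j
    exact hn u hu _) (by
    rintro _ ⟨u, hu, rfl⟩ j hj1 hjN he
    have e1 : M + N - (j - 1) = M + N - j + 1 := by omega
    have e2 : M + N - (j + 1) = M + N - j - 1 := by omega
    simp only [e1, e2] at he ⊢
    refine ⟨_, refl_step Λ hq0 hq1 hu ⟨M + N - j, by omega, by omega⟩
      (by change M + N - j ≠ M; omega) (by change _ + u (M + N - j - 1) + u (M + N - j + 1) - 2 * u (M + N - j) < 0; linarith), ?_⟩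
    funext a
    by_cases ha : a = j
    · subst ha
      simp only [Function.update_self]
      ring
    · rw [Function.update_of_ne ha, Function.update_of_ne]
      change M + N - a ≠ M + N - j
      omega)
  refine ⟨(max B1 B2).toNat + 1, by omega, ?_⟩
  intro u hu i hi1 hi2
  by_cases hiM : i ≤ M
  · have := h1 u hu i hiM
    omega
  · have := h2 _ ⟨u, hu, rfl⟩ (M + N - i) (by omega)
    have e1 : M + N - (M + N - i) = i := by omega
    have e2 : M + N - N = M := by omega
    simp only [e1, e2] at this
    omega

theorem Kgen_gA (i : ℕ) (hi : i < M + N) :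
    ∃ z : Gen M N true, isZ z ∧ Kgen q M N true 3 i = gA q M N z ∧
      ∀ x, isZ x → gA q M N z * gA q M N x = gA q M N x * gA q M N z := by
  unfold Kgen
  split_ifs with h
  · exact ⟨Gen.K0 rfl, trivial, K0A_eq, comm_K0⟩
  · exact ⟨Gen.K ⟨i, by omega, by omega⟩, trivial, KA_eq ⟨i, by omega, by omega⟩,
      comm_K _⟩

theorem weights (hq0 : q ≠ 0) (μ : ℕ → ℂ) (hμ : wt18 q M N Λ μ ≠ ⊥) :
    ∃ u, Wsub Λ u ≠ ⊥ ∧ ∀ i : ℕ, i < M + N → μ i = lamF q M N Λ i *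
              ∏ j ∈ Finset.Icc 1 (M + N - 1), alF q M j i ^ (-(u j)) := by
  obtain ⟨w, hw, hw0⟩ := Submodule.exists_mem_ne_zero_of_ne_bot hμ
  obtain ⟨u, hu, h⟩ := joint_weight (fun i : Fin (M + N) => act Λ (Kgen q M N true 3 i.1))
    (by
      intro i j
      obtain ⟨z, hz, ez, cz⟩ := Kgen_gA (q := q) i.1 i.2
      obtain ⟨x, hx, ex, cx⟩ := Kgen_gA (q := q) j.1 j.2
      ext y
      change Kgen q M N true 3 i.1 • Kgen q M N true 3 j.1 • y =
        Kgen q M N true 3 j.1 • Kgen q M N true 3 i.1 • y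
      rw [← mul_smul, ← mul_smul, ez, ex, cz x hx])
    (Wsub Λ) (fun u i => lamF q M N Λ i.1 *
      ∏ j ∈ Finset.Icc 1 (M + N - 1), alF q M j i.1 ^ (-(u j)))
    (fun u w hw i => Wsub_K Λ hq0 i.1 i.2 hw) (Wsub_top Λ hq0) (fun i => μ i.1) w hw0
    (fun i => hw i.1 i.2)
  exact ⟨u, hu, fun i hi => (congrFun h ⟨i, hi⟩).symm⟩

end QASX

open QAS in
/-- Proposition 4.21: there is `k > 0` such that every weight `μ` of the
universal Weyl module `W(P̲,f,c)` has the form `λ_Λ − Σ u_i α_i` with `u_M − u_i > −k`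
for all `i`; in particular the operators `X^±_{i,0}` act locally nilpotently, i.e.
`W(P̲,f,c)` is integrable. -/
theorem universal_weyl_integrable (q : ℂ) (hq0 : q ≠ 0)
    (hq1 : ∀ k : ℕ, k ≠ 0 → q ^ k ≠ 1) (M N : ℕ) (hM : 1 ≤ M) (hN : 1 ≤ N)
    (Λ : HW q M N) :
    ∃ k : ℕ, 0 < k ∧
      (∀ μ : ℕ → ℂ, wt18 q M N Λ μ ≠ ⊥ →
        ∃ u : ℕ → ℤ,
          (∀ i : ℕ, i < M + N →
            μ i = lamF q M N Λ i *
              ∏ j ∈ Finset.Icc 1 (M + N - 1), alF q M j i ^ (-(u j))) ∧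
          (∀ i : ℕ, 1 ≤ i → i ≤ M + N - 1 → -(k : ℤ) < u M - u i)) ∧
      (∀ i : ℕ, 1 ≤ i → i ≤ M + N - 1 →
        (∀ w : UWeylMod q M N true Λ, ∃ m : ℕ, ((XpA q M N true 3 i 0) ^ m) • w = 0) ∧
        (∀ w : UWeylMod q M N true Λ, ∃ m : ℕ, ((XmA q M N true 3 i 0) ^ m) • w = 0)) := by
  obtain ⟨k, hk, hb⟩ := QASX.bounds Λ hq0 hq1 hM hN
  refine ⟨k, hk, ?_, ?_⟩
  · intro μ hμ
    obtain ⟨u, hu, h⟩ := QASX.weights Λ hq0 μ hμ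
    exact ⟨u, h, hb u hu⟩
  · intro i h1 h2
    have ep := QASX.XpA_eq (q := q) (M := M) (N := N) ⟨i, h1, h2⟩ 0
    have em := QASX.XmA_eq (q := q) (M := M) (N := N) ⟨i, h1, h2⟩ 0
    dsimp only at ep em
    rw [ep, em]
    exact ⟨QASX.nil_xp Λ hq0 _, QASX.nil_xm Λ hq0 _⟩
end
end

section
/- The map ι_{+,−} : T → R_{1,1}, (c, Q, P) ↦ ((ι₊(cQ/P) − ι₋(cQ/P))/(q − q^{−1}), c), is an isomorphism of monoids. In particular: (injectivity) the pair (Q, P) is uniquely determined by its image; (surjectivity) for every (f, c) ∈ R_{1,1}, taking P ∈ 1 + zℂ[z] the nonzero polynomial of minimal degree annihilating f and Q(z) the polynomial c^{−1} P(z)(c + (q − q^{−1}) Σ_{n>0} f_n z^n) (a priori a power series, which is in fact a polynomial of the same degree as P), one has (c, Q, P) ∈ T and ι_{+,−}(c, Q, P) = (f, c); and ι_{+,−} sends products to products and the unit (1, 1, 1) to the unit (0, 1). -/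
noncomputable section

namespace QAS

/-- membership in `R_{1,1}`: `f` is a torsion bilateral series and `f₀ = (c−c⁻¹)/(q−q⁻¹)`. -/
def memR (q : ℂ) (f : ℤ → ℂ) (c : ℂ) : Prop :=
  (∃ Qp : Polynomial ℂ, Qp ≠ 0 ∧ annih Qp f) ∧ c ≠ 0 ∧ f 0 = (c - c⁻¹) / (q - q⁻¹)

/-- the coefficients of `f⁺ = c + (q−q⁻¹) Σ_{s≥1} f_s z^s`. -/
def fplusC (q c : ℂ) (f : ℤ → ℂ) : ℕ → ℂ :=
  fun s => if s = 0 then c else (q - q⁻¹) * f (s : ℤ)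

/-- the coefficients of `f⁻ = c⁻¹ − (q−q⁻¹) Σ_{s≥1} f_{−s} z^{−s}` (at `z^{−s}`). -/
def fminusC (q c : ℂ) (f : ℤ → ℂ) : ℕ → ℂ :=
  fun s => if s = 0 then c⁻¹ else -((q - q⁻¹) * f (-(s : ℤ)))

/-- the product `f∗g = (f⁺g⁺ − f⁻g⁻)/(q−q⁻¹)` of the monoid `R_{1,1}`. -/
def starF (q : ℂ) (f : ℤ → ℂ) (c : ℂ) (g : ℤ → ℂ) (d : ℂ) : ℤ → ℂ := fun n =>
  ((if 0 ≤ n then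
      ∑ s ∈ Finset.range (n.toNat + 1), fplusC q c f s * fplusC q d g (n.toNat - s)
    else 0) -
   (if n ≤ 0 then
      ∑ s ∈ Finset.range ((-n).toNat + 1), fminusC q c f s * fminusC q d g ((-n).toNat - s)
    else 0)) / (q - q⁻¹)

/-- membership in `T`: `c ≠ 0`, `P, Q ∈ 1 + zℂ[z]` coprime, and
`lim_{z→∞} Q/P = c⁻²` (same degree and leading coefficients in ratio `c⁻²`). -/
def memT (c : ℂ) (Qp Pp : Polynomial ℂ) : Prop :=
  c ≠ 0 ∧ Qp.coeff 0 = 1 ∧ Pp.coeff 0 = 1 ∧ IsCoprime Qp Pp ∧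
    Qp.natDegree = Pp.natDegree ∧ Qp.leadingCoeff = c⁻¹ * c⁻¹ * Pp.leadingCoeff

/-- `ι_{+,−}(c,Q,P)`: the bilateral series `(ι₊(cQ/P) − ι₋(cQ/P))/(q−q⁻¹)`, where `ι₊`
is the expansion at `z = 0` and `ι₋` the expansion at `z = ∞` (through the reversed
polynomials in the variable `w = z⁻¹`). -/
def iotaF (q c : ℂ) (Qp Pp : Polynomial ℂ) : ℤ → ℂ := fun n =>
  ((if 0 ≤ n then c * PowerSeries.coeff n.toNat (toPS Qp * (toPS Pp)⁻¹) else 0) -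
   (if n ≤ 0 then
      c * PowerSeries.coeff (-n).toNat
        (toPS (Qp.reflect Pp.natDegree) * (toPS (Pp.reflect Pp.natDegree))⁻¹)
    else 0)) / (q - q⁻¹)

end QAS

namespace QAS

/-- the bilateral series `a(z) - b(z⁻¹)`. -/
def bil (a b : PowerSeries ℂ) : ℤ → ℂ := fun n =>
  (if 0 ≤ n then PowerSeries.coeff n.toNat a else 0) -
    (if n ≤ 0 then PowerSeries.coeff (-n).toNat b else 0)

lemma toPS_eq (p : Polynomial ℂ) : toPS p = (p : PowerSeries ℂ) := by
  ext n; simp [toPS]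

lemma toPS_mul (p r : Polynomial ℂ) : toPS (p * r) = toPS p * toPS r := by
  simp [toPS_eq]

lemma toPS_inj {p r : Polynomial ℂ} (h : toPS p = toPS r) : p = r := by
  rw [toPS_eq, toPS_eq] at h; exact_mod_cast h

lemma coeff_toPS (p : Polynomial ℂ) (n : ℕ) : PowerSeries.coeff n (toPS p) = p.coeff n := by
  simp [toPS]

lemma constCoeff_toPS (p : Polynomial ℂ) : PowerSeries.constantCoeff (toPS p) = p.coeff 0 := by
  rw [← PowerSeries.coeff_zero_eq_constantCoeff_apply, coeff_toPS]

lemma conv_one (p : Polynomial ℂ) (d : ℕ) (hd : p.natDegree ≤ d) (a : PowerSeries ℂ) (n : ℤ) :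
    ∑ s ∈ Finset.range (d + 1), p.coeff s *
      (if 0 ≤ n - s then PowerSeries.coeff (n - s).toNat a else 0) =
    if 0 ≤ n then PowerSeries.coeff n.toNat (toPS p * a) else 0 := by
  split_ifs with h
  · obtain ⟨m, rfl⟩ := Int.eq_ofNat_of_zero_le h
    rw [PowerSeries.coeff_mul, Finset.Nat.sum_antidiagonal_eq_sum_range_succ_mk]
    simp only [coeff_toPS, Int.toNat_natCast]
    have e1 : ∀ s ∈ Finset.range (d + 1), p.coeff s *
        (if 0 ≤ (m : ℤ) - s then PowerSeries.coeff ((m : ℤ) - s).toNat a else 0) =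
        (if s ∈ Finset.range (m+1) then p.coeff s * PowerSeries.coeff (m - s) a else 0) := by
      intro s _
      by_cases hs : s ≤ m
      · have h1 : 0 ≤ (m : ℤ) - s := by omega
        have h2 : ((m : ℤ) - s).toNat = m - s := by omega
        rw [if_pos h1, h2, if_pos (by simp; omega)]
      · rw [if_neg (by omega), if_neg (by simp; omega), mul_zero]
    rw [Finset.sum_congr rfl e1, ← Finset.sum_filter, Finset.filter_mem_eq_inter]
    apply Finset.sum_subset Finset.inter_subset_right
    intro s hs hs'
    have : p.natDegree < s := by
      simp only [Finset.mem_inter, Finset.mem_range] at hs hs'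
      omega
    rw [Polynomial.coeff_eq_zero_of_natDegree_lt this, zero_mul]
  · apply Finset.sum_eq_zero
    intro s _
    rw [if_neg (by omega), mul_zero]

lemma natDegree_reflect_le' (p : Polynomial ℂ) (d : ℕ) (hd : p.natDegree ≤ d) :
    (p.reflect d).natDegree ≤ d := by
  refine Polynomial.natDegree_le_iff_coeff_eq_zero.2 ?_
  intro n hn
  rw [Polynomial.coeff_reflect, Polynomial.revAt_eq_self_of_lt hn]
  exact Polynomial.coeff_eq_zero_of_natDegree_lt (by omega)

lemma conv_bil (p : Polynomial ℂ) (d : ℕ) (hd : p.natDegree ≤ d) (a b : PowerSeries ℂ) (n : ℤ) :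
    ∑ s ∈ Finset.range (d + 1), p.coeff s * bil a b (n - s) =
    (if 0 ≤ n then PowerSeries.coeff n.toNat (toPS p * a) else 0) -
    (if n ≤ d then PowerSeries.coeff (d - n).toNat (toPS (p.reflect d) * b) else 0) := by
  unfold bil
  simp only [mul_sub, Finset.sum_sub_distrib]
  rw [conv_one p d hd]
  congr 1
  have := conv_one (p.reflect d) d (natDegree_reflect_le' p d hd) b (d - n)
  simp only [sub_nonneg] at this
  rw [← this, ← Finset.sum_range_reflect]
  apply Finset.sum_congr rfl
  intro s hs
  have hs : s ≤ d := by simp at hs; omega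
  rw [Polynomial.coeff_reflect, Polynomial.revAt_le hs]
  have h1 : d + 1 - 1 - s = d - s := by omega
  have h2 : -(n - ((d - s : ℕ) : ℤ)) = (d : ℤ) - n - s := by omega
  rw [h1, h2]
  congr 1
  by_cases h : (s : ℤ) ≤ d - n
  · rw [if_pos (by omega), if_pos h]
  · rw [if_neg (by omega), if_neg h]

lemma annih_div {K : ℂ} (hK : K ≠ 0) (p : Polynomial ℂ) (g : ℤ → ℂ) :
    annih p (fun n => g n / K) ↔ annih p g := by
  unfold annih
  refine forall_congr' fun n => ?_
  have : ∑ s ∈ Finset.range (p.natDegree + 1), p.coeff s * (g (n - s) / K) =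
      (∑ s ∈ Finset.range (p.natDegree + 1), p.coeff s * g (n - s)) / K := by
    rw [Finset.sum_div]
    exact Finset.sum_congr rfl fun s _ => by ring
  rw [this, div_eq_zero_iff]
  simp [hK]

lemma annih_of (P R : Polynomial ℂ) (hR : R.natDegree ≤ P.natDegree) (a b : PowerSeries ℂ)
    (ha : toPS P * a = toPS R)
    (hb : toPS (P.reflect P.natDegree) * b = toPS (R.reflect P.natDegree)) :
    annih P (bil a b) := by
  intro n
  rw [conv_bil P _ le_rfl, ha, hb, coeff_toPS, coeff_toPS, Polynomial.coeff_reflect]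
  by_cases h0 : 0 ≤ n
  · obtain ⟨m, rfl⟩ := Int.eq_ofNat_of_zero_le h0
    rw [if_pos h0]
    by_cases hd : m ≤ P.natDegree
    · rw [if_pos (by exact_mod_cast hd), Polynomial.revAt_le (by omega)]
      have : P.natDegree - ((P.natDegree : ℤ) - m).toNat = m := by omega
      rw [this]; simp
    · rw [if_neg (by exact_mod_cast hd), sub_zero]
      exact Polynomial.coeff_eq_zero_of_natDegree_lt (by simp; omega)
  · rw [if_neg h0, if_pos (by omega), Polynomial.revAt_eq_self_of_lt (by omega),
      Polynomial.coeff_eq_zero_of_natDegree_lt (by omega), sub_zero]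

lemma exists_of_annih (P : Polynomial ℂ) (a b : PowerSeries ℂ) (h : annih P (bil a b)) :
    ∃ R : Polynomial ℂ, R.natDegree ≤ P.natDegree ∧ toPS P * a = toPS R ∧
      toPS (P.reflect P.natDegree) * b = toPS (R.reflect P.natDegree) := by
  have key := fun n : ℤ => (conv_bil P _ le_rfl a b n).symm.trans (h n)
  set A := toPS P * a
  set B := toPS (P.reflect P.natDegree) * b
  set d := P.natDegree
  have hA : ∀ m : ℕ, d < m → PowerSeries.coeff m A = 0 := by
    intro m hm
    have := key m
    rw [if_pos (by omega), if_neg (by omega)] at this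
    simpa using this
  have hB : ∀ m : ℕ, d < m → PowerSeries.coeff m B = 0 := by
    intro m hm
    have := key ((d : ℤ) - m)
    rw [if_neg (by omega), if_pos (by omega)] at this
    simpa using this
  have hAB : ∀ m : ℕ, m ≤ d → PowerSeries.coeff m A = PowerSeries.coeff (d - m) B := by
    intro m hm
    have := key m
    have e : ((d : ℤ) - m).toNat = d - m := by omega
    rw [if_pos (by omega), if_pos (by omega), e] at this
    simpa [sub_eq_zero] using this
  refine ⟨PowerSeries.trunc (d + 1) A, ?_, ?_, ?_⟩
  · exact Nat.lt_succ_iff.1 (PowerSeries.natDegree_trunc_lt A d)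
  · ext m
    rw [coeff_toPS, PowerSeries.coeff_trunc]
    split_ifs with hm
    · rfl
    · exact hA m (by omega)
  · ext m
    rw [coeff_toPS, Polynomial.coeff_reflect, PowerSeries.coeff_trunc]
    by_cases hm : m ≤ d
    · rw [Polynomial.revAt_le hm, if_pos (by omega), hAB _ (by omega)]
      congr 2; omega
    · rw [Polynomial.revAt_eq_self_of_lt (by omega), if_neg (by omega)]
      exact hB m (by omega)

lemma coeff_zero_reflect (p : Polynomial ℂ) (d : ℕ) : (p.reflect d).coeff 0 = p.coeff d := by
  rw [Polynomial.coeff_reflect, Polynomial.revAt_le (Nat.zero_le _), Nat.sub_zero]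

/-- the expansion at zero. -/
def ea (c : ℂ) (Q P : Polynomial ℂ) : PowerSeries ℂ :=
  PowerSeries.C c * (toPS Q * (toPS P)⁻¹)

/-- the expansion at infinity. -/
def eb (c : ℂ) (Q P : Polynomial ℂ) : PowerSeries ℂ :=
  PowerSeries.C c * (toPS (Q.reflect P.natDegree) * (toPS (P.reflect P.natDegree))⁻¹)

lemma iotaF_eq (q c : ℂ) (Q P : Polynomial ℂ) :
    iotaF q c Q P = fun n => bil (ea c Q P) (eb c Q P) n / (q - q⁻¹) := by
  funext n
  simp only [iotaF, bil, ea, eb, PowerSeries.coeff_C_mul]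

lemma mul_ea (c : ℂ) (Q P : Polynomial ℂ) (hP : P.coeff 0 = 1) :
    toPS P * ea c Q P = toPS (Polynomial.C c * Q) := by
  have h : toPS P * (toPS P)⁻¹ = 1 := PowerSeries.mul_inv_cancel _ (by
    rw [constCoeff_toPS, hP]; exact one_ne_zero)
  have hc : toPS (Polynomial.C c) = PowerSeries.C c := by rw [toPS_eq]; simp
  rw [toPS_mul, hc, ea]
  linear_combination PowerSeries.C c * toPS Q * h

lemma ne_zero_of_coeff {P : Polynomial ℂ} (hP : P.coeff 0 = 1) : P ≠ 0 := by
  rintro rfl; simp at hP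

lemma mul_eb (c : ℂ) (Q P : Polynomial ℂ) (hP : P.coeff 0 = 1) :
    toPS (P.reflect P.natDegree) * eb c Q P =
      toPS ((Polynomial.C c * Q).reflect P.natDegree) := by
  have h : toPS (P.reflect P.natDegree) * (toPS (P.reflect P.natDegree))⁻¹ = 1 :=
    PowerSeries.mul_inv_cancel _ (by
      rw [constCoeff_toPS, coeff_zero_reflect]
      exact Polynomial.leadingCoeff_ne_zero.2 (ne_zero_of_coeff hP))
  have hc : toPS (Polynomial.C c) = PowerSeries.C c := by rw [toPS_eq]; simp
  rw [Polynomial.reflect_C_mul, toPS_mul, hc, eb]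
  linear_combination PowerSeries.C c * toPS (Q.reflect P.natDegree) * h

lemma coeff_zero_ea (c : ℂ) (Q P : Polynomial ℂ) (h : memT c Q P) :
    PowerSeries.coeff 0 (ea c Q P) = c := by
  obtain ⟨hc, hQ, hP, -⟩ := h
  simp [ea, constCoeff_toPS, hQ, hP]

lemma coeff_zero_eb (c : ℂ) (Q P : Polynomial ℂ) (h : memT c Q P) :
    PowerSeries.coeff 0 (eb c Q P) = c⁻¹ := by
  obtain ⟨hc, hQ, hP, -, hd, hl⟩ := h
  have hl0 : P.leadingCoeff ≠ 0 := Polynomial.leadingCoeff_ne_zero.2 (ne_zero_of_coeff hP)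
  have h1 : Q.coeff P.natDegree = c⁻¹ * c⁻¹ * P.leadingCoeff := by rw [← hd]; exact hl
  have h2 : PowerSeries.coeff 0 (eb c Q P) = c * (Q.coeff P.natDegree * (P.leadingCoeff)⁻¹) := by
    simp [eb, constCoeff_toPS, coeff_zero_reflect]
  rw [h2, h1]
  field_simp

lemma mk_fplus {q c : ℂ} (hK : q - q⁻¹ ≠ 0) (a b : PowerSeries ℂ)
    (h0 : PowerSeries.coeff 0 a = c) (s : ℕ) :
    fplusC q c (fun n => bil a b n / (q - q⁻¹)) s = PowerSeries.coeff s a := by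
  unfold fplusC bil
  by_cases h : s = 0
  · rw [if_pos h, h, h0]
  · rw [if_neg h]
    beta_reduce
    rw [if_pos (by omega), if_neg (by omega), mul_div_cancel₀ _ hK]; simp

lemma mk_fminus {q c : ℂ} (hK : q - q⁻¹ ≠ 0) (a b : PowerSeries ℂ)
    (h0 : PowerSeries.coeff 0 b = c⁻¹) (s : ℕ) :
    fminusC q c (fun n => bil a b n / (q - q⁻¹)) s = PowerSeries.coeff s b := by
  unfold fminusC bil
  by_cases h : s = 0
  · rw [if_pos h, h, h0]
  · rw [if_neg h]
    beta_reduce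
    rw [if_neg (by omega), if_pos (by omega), mul_div_cancel₀ _ hK]; simp

lemma bil_f {q c : ℂ} (hK : q - q⁻¹ ≠ 0) (f : ℤ → ℂ) (h0 : f 0 = (c - c⁻¹) / (q - q⁻¹)) :
    f = fun n => bil (PowerSeries.mk (fplusC q c f)) (PowerSeries.mk (fminusC q c f)) n
      / (q - q⁻¹) := by
  funext n
  rw [eq_div_iff hK]
  unfold bil
  simp only [PowerSeries.coeff_mk, fplusC, fminusC]
  rcases lt_trichotomy n 0 with h | rfl | h
  · rw [if_neg (by omega), if_pos (by omega), if_neg (by omega)]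
    have : -(((-n).toNat : ℕ) : ℤ) = n := by omega
    rw [this]; ring
  · rw [h0, div_mul_cancel₀ _ hK]; simp
  · rw [if_pos (by omega), if_neg (by omega), if_neg (by omega)]
    have : ((n.toNat : ℕ) : ℤ) = n := by omega
    rw [this]; ring

lemma star_bil {q c c' : ℂ} (hK : q - q⁻¹ ≠ 0) (a b a' b' : PowerSeries ℂ)
    (h0 : PowerSeries.coeff 0 a = c) (h1 : PowerSeries.coeff 0 b = c⁻¹)
    (h0' : PowerSeries.coeff 0 a' = c') (h1' : PowerSeries.coeff 0 b' = c'⁻¹) :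
    starF q (fun n => bil a b n / (q - q⁻¹)) c (fun n => bil a' b' n / (q - q⁻¹)) c' =
      fun n => bil (a * a') (b * b') n / (q - q⁻¹) := by
  funext n
  unfold starF
  simp only [mk_fplus hK a b h0, mk_fplus hK a' b' h0', mk_fminus hK a b h1,
    mk_fminus hK a' b' h1']
  simp only [bil, PowerSeries.coeff_mul, Finset.Nat.sum_antidiagonal_eq_sum_range_succ_mk]

lemma K_ne {q : ℂ} (hq0 : q ≠ 0) (hq1 : ∀ k : ℕ, k ≠ 0 → q ^ k ≠ 1) : q - q⁻¹ ≠ 0 := by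
  intro h
  apply hq1 2 two_ne_zero
  have : q = q⁻¹ := sub_eq_zero.1 h
  rw [sq]; nth_rewrite 2 [this]; exact mul_inv_cancel₀ hq0

lemma part1 {q : ℂ} (hK : q - q⁻¹ ≠ 0) (c : ℂ) (Q P : Polynomial ℂ) (h : memT c Q P) :
    memR q (iotaF q c Q P) c := by
  have h' := h
  obtain ⟨hc, hQ, hP, hco, hd, hl⟩ := h'
  refine ⟨⟨P, ne_zero_of_coeff hP, ?_⟩, hc, ?_⟩
  · rw [iotaF_eq, annih_div hK]
    refine annih_of P (Polynomial.C c * Q) ?_ _ _ (mul_ea c Q P hP) (mul_eb c Q P hP)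
    rw [Polynomial.natDegree_C_mul hc, hd]
  · rw [iotaF_eq]
    have e1 := coeff_zero_ea c Q P h
    have e2 := coeff_zero_eb c Q P h
    simp only [bil, le_refl, if_true, neg_zero, Int.toNat_zero, e1, e2]

lemma eq_of_dvd_dvd {p r : Polynomial ℂ} (h1 : p ∣ r) (h2 : r ∣ p) (hp : p.coeff 0 = 1)
    (hr : r.coeff 0 = 1) : p = r := by
  obtain ⟨u, hu⟩ := associated_of_dvd_dvd h1 h2
  obtain ⟨k, hk, hk'⟩ := Polynomial.isUnit_iff.1 u.isUnit
  rw [← hk'] at hu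
  have : k = 1 := by
    have := congrArg (fun t => Polynomial.coeff t 0) hu
    simpa [hp, hr] using this
  rw [← hu, this]; simp

lemma part2 {q : ℂ} (hK : q - q⁻¹ ≠ 0) (c : ℂ) (Q P Q' P' : Polynomial ℂ)
    (h : memT c Q P) (h' : memT c Q' P') (he : iotaF q c Q P = iotaF q c Q' P') :
    Q = Q' ∧ P = P' := by
  have hea : ea c Q P = ea c Q' P' := by
    ext s
    rw [← mk_fplus hK _ (eb c Q P) (coeff_zero_ea c Q P h),
      ← mk_fplus hK _ (eb c Q' P') (coeff_zero_ea c Q' P' h'), ← iotaF_eq, ← iotaF_eq, he]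
  obtain ⟨hc, hQ, hP, hco, hd, hl⟩ := h
  obtain ⟨-, hQ', hP', hco', hd', hl'⟩ := h'
  have e1 := mul_ea c Q P hP
  have e2 := mul_ea c Q' P' hP'
  rw [← hea] at e2
  have e3 : P' * (Polynomial.C c * Q) = P * (Polynomial.C c * Q') := by
    apply toPS_inj
    rw [toPS_mul, toPS_mul P, ← e1, ← e2]; ring
  have e4 : P' * Q = P * Q' := by
    have : Polynomial.C c ≠ 0 := by simpa using hc
    apply mul_left_cancel₀ this
    linear_combination e3
  refine ⟨eq_of_dvd_dvd ?_ ?_ hQ hQ', eq_of_dvd_dvd ?_ ?_ hP hP'⟩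
  · exact hco.dvd_of_dvd_mul_left ⟨P', by rw [← e4]; ring⟩
  · exact hco'.dvd_of_dvd_mul_left ⟨P, by rw [e4]; ring⟩
  · exact hco.symm.dvd_of_dvd_mul_right ⟨Q', e4⟩
  · exact hco'.symm.dvd_of_dvd_mul_right ⟨Q, e4.symm⟩

lemma toPS_C (c : ℂ) : toPS (Polynomial.C c) = PowerSeries.C c := by rw [toPS_eq]; simp

lemma toPS_ne {p : Polynomial ℂ} (h : p ≠ 0) : toPS p ≠ 0 := by
  intro h'
  apply h; apply toPS_inj; rw [h', toPS_eq]; simp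

lemma part3 {q : ℂ} (hK : q - q⁻¹ ≠ 0) (f : ℤ → ℂ) (c : ℂ) (hR : memR q f c)
    (P : Polynomial ℂ) (hP : P.coeff 0 = 1) (hann : annih P f)
    (hmin : ∀ P' : Polynomial ℂ, P' ≠ 0 → annih P' f → P.natDegree ≤ P'.natDegree) :
    ∃ Q : Polynomial ℂ,
      toPS Q = PowerSeries.C c⁻¹ * (toPS P * PowerSeries.mk (fplusC q c f)) ∧
      Q.natDegree = P.natDegree ∧ memT c Q P ∧ iotaF q c Q P = f := by
  obtain ⟨-, hc, h0⟩ := hR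
  have hP0 := ne_zero_of_coeff hP
  have hf := bil_f hK f h0
  set a := PowerSeries.mk (fplusC q c f) with ha
  set b := PowerSeries.mk (fminusC q c f) with hb
  have hann' : annih P (bil a b) := by rw [hf, annih_div hK] at hann; exact hann
  obtain ⟨R, hRd, hPa, hPb⟩ := exists_of_annih P a b hann'
  have hRQ : Polynomial.C c * (Polynomial.C c⁻¹ * R) = R := by
    rw [← mul_assoc, ← Polynomial.C_mul, mul_inv_cancel₀ hc]; simp
  have hl0 : P.leadingCoeff ≠ 0 := Polynomial.leadingCoeff_ne_zero.2 hP0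
  have hR0 : R.coeff 0 = c := by
    rw [← constCoeff_toPS, ← hPa]
    simp [constCoeff_toPS, hP, ha, fplusC]
  have hRl : R.coeff P.natDegree = P.leadingCoeff * c⁻¹ := by
    rw [← coeff_zero_reflect, ← constCoeff_toPS, ← hPb]
    simp [constCoeff_toPS, coeff_zero_reflect, hb, fminusC]
  have hRne : R.coeff P.natDegree ≠ 0 := by
    rw [hRl]; exact mul_ne_zero hl0 (inv_ne_zero hc)
  have hRdeg : R.natDegree = P.natDegree :=
    le_antisymm hRd (Polynomial.le_natDegree_of_ne_zero hRne)
  have hQdeg : (Polynomial.C c⁻¹ * R).natDegree = P.natDegree := by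
    rw [Polynomial.natDegree_C_mul (inv_ne_zero hc), hRdeg]
  have hcop : IsCoprime R P := by
    rw [isCoprime_comm, ← EuclideanDomain.gcd_isUnit_iff]
    obtain ⟨P1, hP1⟩ := EuclideanDomain.gcd_dvd_left P R
    obtain ⟨R1, hR1⟩ := EuclideanDomain.gcd_dvd_right P R
    set D := EuclideanDomain.gcd P R
    have hD0 : D ≠ 0 := by intro h; rw [h, zero_mul] at hP1; exact hP0 hP1
    have hP10 : P1 ≠ 0 := by intro h; rw [h, mul_zero] at hP1; exact hP0 hP1
    have hR10 : R1 ≠ 0 := by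
      intro h; rw [h, mul_zero] at hR1; rw [hR1] at hRne; simp at hRne
    have hPdeg : P.natDegree = D.natDegree + P1.natDegree := by
      conv_lhs => rw [hP1]
      exact Polynomial.natDegree_mul hD0 hP10
    have hRdeg' : R.natDegree = D.natDegree + R1.natDegree := by
      conv_lhs => rw [hR1]
      exact Polynomial.natDegree_mul hD0 hR10
    have hle : R1.natDegree ≤ P1.natDegree := by omega
    have hann1 : annih P1 (bil a b) := by
      refine annih_of P1 R1 hle a b ?_ ?_
      · apply mul_left_cancel₀ (toPS_ne hD0)
        rw [← toPS_mul, ← hR1, ← hPa, ← mul_assoc, ← toPS_mul, ← hP1]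
      · have hDr : D.reflect D.natDegree ≠ 0 := by
          rw [Ne, Polynomial.reflect_eq_zero_iff]; exact hD0
        apply mul_left_cancel₀ (toPS_ne hDr)
        rw [← toPS_mul, ← mul_assoc, ← toPS_mul, ← Polynomial.reflect_mul _ _ le_rfl hle,
          ← Polynomial.reflect_mul _ _ le_rfl le_rfl, ← hPdeg, ← hR1, ← hP1, hPb]
    have hann2 : annih P1 f := by rw [hf, annih_div hK]; exact hann1
    have := hmin P1 hP10 hann2
    exact Polynomial.isUnit_iff_degree_eq_zero.2
      (by rw [Polynomial.degree_eq_natDegree hD0]; norm_cast; omega)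
  refine ⟨Polynomial.C c⁻¹ * R, ?_, hQdeg, ⟨hc, ?_, hP, ?_, hQdeg, ?_⟩, ?_⟩
  · rw [toPS_mul, toPS_C, hPa]
  · simp [hR0, hc]
  · rw [isCoprime_mul_unit_left_left (Polynomial.isUnit_C.2 (inv_ne_zero hc).isUnit)]
    exact hcop
  · rw [Polynomial.leadingCoeff, hQdeg, Polynomial.coeff_C_mul, hRl]; ring
  · rw [iotaF_eq]
    have e1 := mul_ea c (Polynomial.C c⁻¹ * R) P hP
    have e2 := mul_eb c (Polynomial.C c⁻¹ * R) P hP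
    rw [hRQ, ← hPa] at e1
    rw [hRQ, ← hPb] at e2
    have hPr : P.reflect P.natDegree ≠ 0 := by
      rw [Ne, Polynomial.reflect_eq_zero_iff]; exact hP0
    rw [mul_left_cancel₀ (toPS_ne hP0) e1, mul_left_cancel₀ (toPS_ne hPr) e2]
    exact hf.symm

lemma part4 {q : ℂ} (hK : q - q⁻¹ ≠ 0) (c : ℂ) (Q P : Polynomial ℂ) (c' : ℂ)
    (Q' P' : Polynomial ℂ) (h : memT c Q P) (h' : memT c' Q' P') :
    iotaF q (c * c') (Q * Q') (P * P') = starF q (iotaF q c Q P) c (iotaF q c' Q' P') c' := by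
  rw [iotaF_eq, iotaF_eq, iotaF_eq, star_bil hK _ _ _ _ (coeff_zero_ea c Q P h)
    (coeff_zero_eb c Q P h) (coeff_zero_ea c' Q' P' h') (coeff_zero_eb c' Q' P' h')]
  obtain ⟨hc, hQ, hP, hco, hd, hl⟩ := h
  obtain ⟨-, hQ', hP', hco', hd', hl'⟩ := h'
  have e1 : ea (c * c') (Q * Q') (P * P') = ea c Q P * ea c' Q' P' := by
    simp only [ea, toPS_mul, PowerSeries.mul_inv_rev, map_mul]; ring
  have e2 : eb (c * c') (Q * Q') (P * P') = eb c Q P * eb c' Q' P' := by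
    simp only [eb]
    rw [Polynomial.natDegree_mul (ne_zero_of_coeff hP) (ne_zero_of_coeff hP'),
      Polynomial.reflect_mul _ _ le_rfl le_rfl, Polynomial.reflect_mul _ _ hd.le hd'.le]
    simp only [toPS_mul, PowerSeries.mul_inv_rev, map_mul]; ring
  rw [e1, e2]

lemma part5 (q : ℂ) : iotaF q 1 1 1 = fun _ => 0 := by
  have h1 : toPS 1 = 1 := by rw [toPS_eq]; simp
  have hi : (1 : PowerSeries ℂ)⁻¹ = 1 := by
    rw [PowerSeries.inv_eq_iff_mul_eq_one] <;> simp
  funext n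
  simp only [iotaF, Polynomial.natDegree_one, Polynomial.reflect_one, pow_zero, h1, hi, mul_one,
    one_mul, PowerSeries.coeff_one]
  rcases lt_trichotomy n 0 with h | rfl | h
  · rw [if_neg (by omega), if_pos (by omega), if_neg (by omega)]; simp
  · simp
  · rw [if_pos (by omega), if_neg (by omega), if_neg (by omega)]; simp

end QAS

open QAS in
/-- `ι_{+,−} : T → R_{1,1}` is an isomorphism of monoids: it is
well-defined, injective, surjective (with the explicit minimal-annihilator construction
of the preimage), multiplicative, and sends the unit to the unit. -/
theorem iota_monoid_iso (q : ℂ) (hq0 : q ≠ 0)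
    (hq1 : ∀ k : ℕ, k ≠ 0 → q ^ k ≠ 1) :
    (∀ (c : ℂ) (Qp Pp : Polynomial ℂ), memT c Qp Pp → memR q (iotaF q c Qp Pp) c) ∧
    (∀ (c : ℂ) (Qp Pp : Polynomial ℂ) (c' : ℂ) (Qp' Pp' : Polynomial ℂ),
      memT c Qp Pp → memT c' Qp' Pp' →
      iotaF q c Qp Pp = iotaF q c' Qp' Pp' → c = c' → Qp = Qp' ∧ Pp = Pp') ∧
    (∀ (f : ℤ → ℂ) (c : ℂ), memR q f c →
      ∀ Pp : Polynomial ℂ, Pp.coeff 0 = 1 → annih Pp f →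
        (∀ P' : Polynomial ℂ, P' ≠ 0 → annih P' f → Pp.natDegree ≤ P'.natDegree) →
        ∃ Qp : Polynomial ℂ,
          toPS Qp = PowerSeries.C c⁻¹ *
            (toPS Pp * PowerSeries.mk (fun n => if n = 0 then c else (q - q⁻¹) * f (n : ℤ))) ∧
          Qp.natDegree = Pp.natDegree ∧ memT c Qp Pp ∧ iotaF q c Qp Pp = f) ∧
    (∀ (c : ℂ) (Qp Pp : Polynomial ℂ) (c' : ℂ) (Qp' Pp' : Polynomial ℂ),
      memT c Qp Pp → memT c' Qp' Pp' →
      iotaF q (c * c') (Qp * Qp') (Pp * Pp') =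
        starF q (iotaF q c Qp Pp) c (iotaF q c' Qp' Pp') c') ∧
    iotaF q 1 1 1 = fun _ => 0 := by
  have hK := K_ne hq0 hq1
  refine ⟨part1 hK, ?_, ?_, part4 hK, part5 q⟩
  · intro c Qp Pp c' Qp' Pp' h h' he hcc
    subst hcc
    exact part2 hK c Qp Pp Qp' Pp' h h' he
  · intro f c hR Pp hP hann hmin
    exact part3 hK f c hR Pp hP hann hmin
end
end
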